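/- Let Γ be a finite simple graph on vertex set V and let p ∈ ℤ[q] be its chromatic polynomial, i.e. the (unique) integer polynomial such that for every natural number n, p(n) equals the number of proper colorings of Γ with n colors. Then the absolute values of the coefficients of p form a log-concave sequence: for every i ≥ 1, |coeff_{i−1}(p)| · |coeff_{i+1}(p)| ≤ |coeff_i(p)|² (Huh's theorem on log-concavity of the chromatic polynomial). -/

import Mathlib

namespace HRW

open scoped Classical

set_option linter.unusedSectionVars false

section Part1


/-- A finite (loopless) matroid presented by its flats. -/
structure FlatSys (E : Type*) [Fintype E] [DecidableEq E] where
  IsFlat : Finset E → Prop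
  rk : Finset E → ℕ
  empty : IsFlat ∅
  univ : IsFlat Finset.univ
  rk_empty : rk ∅ = 0
  rk_lt : ∀ A B, IsFlat A → IsFlat B → A ⊂ B → rk A < rk B
  cover : ∀ A e, IsFlat A → e ∉ A → ∃ G, IsFlat G ∧ A ⊆ G ∧ e ∈ G ∧ rk G = rk A + 1 ∧
    ∀ B, IsFlat B → A ⊆ B → e ∈ B → G ⊆ B

variable {E : Type*} [Fintype E] [DecidableEq E] (M : FlatSys E)

/-- Chains of flats containing the bottom and the top. -/
def IsCh (C : Finset (Finset E)) : Prop :=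
  (∀ A ∈ C, M.IsFlat A) ∧ (∀ A ∈ C, ∀ B ∈ C, A ⊆ B ∨ B ⊆ A) ∧ ∅ ∈ C ∧ Finset.univ ∈ C

/-- Flats which extend a chain. -/
noncomputable def Ext (C : Finset (Finset E)) : Finset (Finset E) :=
  Finset.univ.filter (fun F => F ∉ C ∧ IsCh M (insert F C))

/-- Consecutive elements of a chain. -/
def Gap (C : Finset (Finset E)) (A B : Finset E) : Prop :=
  A ∈ C ∧ B ∈ C ∧ A ⊂ B ∧ ∀ D ∈ C, D ⊆ A ∨ B ⊆ D

/-- the rank of the matroid -/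
def FlatSys.r : ℕ := M.rk Finset.univ

variable {M}

lemma mem_Ext {C : Finset (Finset E)} {F : Finset E} :
    F ∈ Ext M C ↔ F ∉ C ∧ IsCh M (insert F C) := by simp [Ext]

lemma rk_mono {A B : Finset E} (hA : M.IsFlat A) (hB : M.IsFlat B) (h : A ⊆ B) :
    M.rk A ≤ M.rk B := by
  rcases h.eq_or_ssubset with h | h
  · rw [h]
  · exact (M.rk_lt A B hA hB h).le

lemma eq_of_rk {A B : Finset E} (hA : M.IsFlat A) (hB : M.IsFlat B) (h : A ⊆ B)
    (h' : M.rk B ≤ M.rk A) : A = B := by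
  rcases h.eq_or_ssubset with h | h
  · exact h
  · exact absurd (M.rk_lt A B hA hB h) (by omega)

lemma IsCh.sub {C : Finset (Finset E)} (hC : IsCh M C) {A B : Finset E} (hA : A ∈ C) (hB : B ∈ C)
    (h : M.rk A ≤ M.rk B) : A ⊆ B := by
  rcases hC.2.1 A hA B hB with h1 | h1
  · exact h1
  · rw [eq_of_rk (hC.1 B hB) (hC.1 A hA) h1 h]

lemma IsCh.ssub {C : Finset (Finset E)} (hC : IsCh M C) {A B : Finset E} (hA : A ∈ C) (hB : B ∈ C)
    (h : M.rk A < M.rk B) : A ⊂ B := by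
  refine (hC.sub hA hB h.le).ssubset_of_ne ?_
  rintro rfl
  omega

lemma IsCh.inj {C : Finset (Finset E)} (hC : IsCh M C) {A B : Finset E} (hA : A ∈ C) (hB : B ∈ C)
    (h : M.rk A = M.rk B) : A = B :=
  (hC.sub hA hB h.le).antisymm (hC.sub hB hA h.ge)

lemma rk_le_r {A : Finset E} (hA : M.IsFlat A) : M.rk A ≤ M.r :=
  rk_mono hA M.univ (Finset.subset_univ A)

lemma IsCh.card_image {C : Finset (Finset E)} (hC : IsCh M C) : (C.image M.rk).card = C.card :=
  Finset.card_image_of_injOn (fun _ hA _ hB h => hC.inj hA hB h)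

lemma IsCh.image_sub {C : Finset (Finset E)} (hC : IsCh M C) :
    C.image M.rk ⊆ Finset.range (M.r + 1) := by
  intro k hk
  obtain ⟨A, hA, rfl⟩ := Finset.mem_image.1 hk
  exact Finset.mem_range.2 (Nat.lt_succ_of_le (rk_le_r (hC.1 A hA)))

lemma IsCh.card_le {C : Finset (Finset E)} (hC : IsCh M C) : C.card ≤ M.r + 1 := by
  rw [← hC.card_image]
  simpa using Finset.card_le_card hC.image_sub

/-- missing ranks -/
noncomputable def miss (M : FlatSys E) (C : Finset (Finset E)) : Finset ℕ :=
  Finset.range (M.r + 1) \ C.image M.rk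

lemma mem_miss {C : Finset (Finset E)} {k : ℕ} :
    k ∈ miss M C ↔ k ≤ M.r ∧ ∀ D ∈ C, M.rk D ≠ k := by
  simp [miss]

lemma IsCh.card_miss {C : Finset (Finset E)} (hC : IsCh M C) :
    (miss M C).card + C.card = M.r + 1 := by
  rw [miss, Finset.card_sdiff_of_subset hC.image_sub, hC.card_image, Finset.card_range]
  have := hC.card_le
  omega

lemma IsCh.gap {C : Finset (Finset E)} (hC : IsCh M C) {k : ℕ} (hk : k ∈ miss M C) :
    ∃ A B, Gap C A B ∧ M.rk A < k ∧ k < M.rk B := by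
  rw [mem_miss] at hk
  have h1 : (C.filter (fun D => M.rk D < k)).Nonempty :=
    ⟨∅, by
      have := hk.2 ∅ hC.2.2.1
      rw [M.rk_empty] at this
      simp [hC.2.2.1, M.rk_empty]; omega⟩
  have h2 : (C.filter (fun D => k < M.rk D)).Nonempty :=
    ⟨Finset.univ, by
      have := hk.2 _ hC.2.2.2
      have h3 := hk.1
      simp only [FlatSys.r] at h3
      simp [hC.2.2.2]; omega⟩
  obtain ⟨A, hA, hA'⟩ := Finset.exists_max_image _ M.rk h1
  obtain ⟨B, hB, hB'⟩ := Finset.exists_min_image _ M.rk h2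
  simp only [Finset.mem_filter] at hA hB hA' hB'
  refine ⟨A, B, ⟨hA.1, hB.1, hC.ssub hA.1 hB.1 (by omega), ?_⟩, hA.2, hB.2⟩
  intro D hD
  rcases lt_trichotomy (M.rk D) k with h | h | h
  · exact Or.inl (hC.sub hD hA.1 (hA' D ⟨hD, h⟩))
  · exact absurd h (hk.2 D hD)
  · exact Or.inr (hC.sub hB.1 hD (hB' D ⟨hD, h⟩))

lemma IsCh.gap_below {C : Finset (Finset E)} (hC : IsCh M C) {B : Finset E} (hB : B ∈ C)
    (hne : B ≠ ∅) : ∃ A, Gap C A B := by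
  have h0 : M.rk ∅ < M.rk B := M.rk_lt _ _ M.empty (hC.1 B hB)
    (Finset.empty_ssubset.2 (Finset.nonempty_iff_ne_empty.2 hne))
  have h1 : (C.filter (fun D => M.rk D < M.rk B)).Nonempty :=
    ⟨∅, by simp [hC.2.2.1]; exact h0⟩
  obtain ⟨A, hA, hA'⟩ := Finset.exists_max_image _ M.rk h1
  simp only [Finset.mem_filter] at hA hA'
  refine ⟨A, hA.1, hB, hC.ssub hA.1 hB hA.2, ?_⟩
  intro D hD
  rcases lt_or_ge (M.rk D) (M.rk B) with h | h
  · exact Or.inl (hC.sub hD hA.1 (hA' D ⟨hD, h⟩))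
  · exact Or.inr (hC.sub hB hD h)

lemma IsCh.insert_of {C : Finset (Finset E)} (hC : IsCh M C) {F : Finset E} (hF : M.IsFlat F)
    (h : ∀ D ∈ C, D ⊆ F ∨ F ⊆ D) : IsCh M (insert F C) := by
  refine ⟨?_, ?_, Finset.mem_insert_of_mem hC.2.2.1, Finset.mem_insert_of_mem hC.2.2.2⟩
  · intro A hA
    rcases Finset.mem_insert.1 hA with rfl | hA
    · exact hF
    · exact hC.1 A hA
  · intro A hA B hB
    rcases Finset.mem_insert.1 hA with hA' | hA' <;> rcases Finset.mem_insert.1 hB with hB' | hB'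
    · rw [hA', hB']; exact Or.inl subset_rfl
    · rw [hA']; exact (h B hB').symm
    · rw [hB']; exact h A hA'
    · exact hC.2.1 A hA' B hB'

lemma ext_cmp {C : Finset (Finset E)} {F D : Finset E} (hF : F ∈ Ext M C) (hD : D ∈ C) :
    D ⊂ F ∨ F ⊂ D := by
  rw [mem_Ext] at hF
  have hne : D ≠ F := by rintro rfl; exact hF.1 hD
  rcases hF.2.2.1 D (Finset.mem_insert_of_mem hD) F (Finset.mem_insert_self _ _) with h | h
  · exact Or.inl (h.ssubset_of_ne hne)
  · exact Or.inr (h.ssubset_of_ne hne.symm)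

lemma ext_flat {C : Finset (Finset E)} {F : Finset E} (hF : F ∈ Ext M C) : M.IsFlat F :=
  (mem_Ext.1 hF).2.1 F (Finset.mem_insert_self _ _)

lemma ext_ch {C : Finset (Finset E)} {F : Finset E} (hF : F ∈ Ext M C) : IsCh M (insert F C) :=
  (mem_Ext.1 hF).2

lemma ext_card {C : Finset (Finset E)} {F : Finset E} (hF : F ∈ Ext M C) :
    (insert F C).card = C.card + 1 := Finset.card_insert_of_notMem (mem_Ext.1 hF).1

lemma ext_miss {C : Finset (Finset E)} {F : Finset E} (hF : F ∈ Ext M C) :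
    M.rk F ∈ miss M C := by
  rw [mem_miss]
  refine ⟨rk_le_r (ext_flat hF), ?_⟩
  intro D hD h
  have := (ext_ch hF).inj (Finset.mem_insert_of_mem hD) (Finset.mem_insert_self F C) h
  exact (mem_Ext.1 hF).1 (this ▸ hD)

lemma Gap.mid {C : Finset (Finset E)} {A B F : Finset E} (h : Gap C A B)
    (hF : F ∈ Ext M C) : F ⊂ A ∨ (A ⊂ F ∧ F ⊂ B) ∨ B ⊂ F := by
  rcases ext_cmp hF h.1 with h1 | h1
  · rcases ext_cmp hF h.2.1 with h2 | h2
    · exact Or.inr (Or.inr h2)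
    · exact Or.inr (Or.inl ⟨h1, h2⟩)
  · exact Or.inl h1

lemma Gap.mem_ext {C : Finset (Finset E)} (hC : IsCh M C) {A B F : Finset E} (h : Gap C A B)
    (hF : M.IsFlat F) (h1 : A ⊂ F) (h2 : F ⊂ B) : F ∈ Ext M C := by
  refine mem_Ext.2 ⟨?_, hC.insert_of hF ?_⟩
  · intro hmem
    rcases h.2.2.2 F hmem with h3 | h3
    · exact h1.not_subset h3
    · exact h2.not_subset h3
  · intro D hD
    rcases h.2.2.2 D hD with h3 | h3
    · exact Or.inl (h3.trans h1.subset)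
    · exact Or.inr (h2.subset.trans h3)

lemma ext_gap {C : Finset (Finset E)} (hC : IsCh M C) {F : Finset E} (hF : F ∈ Ext M C) :
    ∃ A B, Gap C A B ∧ A ⊂ F ∧ F ⊂ B := by
  obtain ⟨A, B, h, h1, h2⟩ := hC.gap (ext_miss hF)
  refine ⟨A, B, h, ?_, ?_⟩
  · exact (ext_ch hF).ssub (Finset.mem_insert_of_mem h.1) (Finset.mem_insert_self _ _) h1
  · exact (ext_ch hF).ssub (Finset.mem_insert_self _ _) (Finset.mem_insert_of_mem h.2.1) h2

/-- covers inside a nontrivial gap -/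
lemma Gap.cover {C : Finset (Finset E)} (hC : IsCh M C) {A B : Finset E} (h : Gap C A B)
    (hr : M.rk A + 1 < M.rk B) {e : E} (he : e ∈ B) (he' : e ∉ A) :
    ∃ G ∈ Ext M C, A ⊂ G ∧ G ⊂ B ∧ e ∈ G ∧ M.rk G = M.rk A + 1 ∧
      ∀ D, M.IsFlat D → A ⊆ D → e ∈ D → G ⊆ D := by
  obtain ⟨G, h1, h2, h3, h4, h5⟩ := M.cover A e (hC.1 A h.1) he'
  have hAG : A ⊂ G := h2.ssubset_of_ne (by rintro rfl; exact he' h3)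
  have hGB : G ⊂ B := (h5 B (hC.1 B h.2.1) h.2.2.1.subset he).ssubset_of_ne
    (by rintro rfl; omega)
  exact ⟨G, h.mem_ext hC h1 hAG hGB, hAG, hGB, h3, h4, h5⟩

lemma Gap.exists_mem {C : Finset (Finset E)} {A B : Finset E} (h : Gap C A B) :
    ∃ e, e ∈ B ∧ e ∉ A := by
  obtain ⟨e, he⟩ := Finset.exists_of_ssubset h.2.2.1
  exact ⟨e, he⟩

/-- every missing rank which is minimal in its gap is filled -/
lemma IsCh.ext_nonempty {C : Finset (Finset E)} (hC : IsCh M C) (h : C.card < M.r + 1) :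
    (Ext M C).Nonempty := by
  have h1 : (miss M C).Nonempty := by
    rw [← Finset.card_pos]
    have := hC.card_miss
    omega
  obtain ⟨k, hk⟩ := h1
  obtain ⟨A, B, hg, h1, h2⟩ := hC.gap hk
  obtain ⟨e, he, he'⟩ := hg.exists_mem
  obtain ⟨G, hG, -⟩ := hg.cover hC (by omega) he he'
  exact ⟨G, hG⟩

lemma mem_ext_ext {C : Finset (Finset E)} (hC : IsCh M C) {F G : Finset E} :
    F ∈ Ext M C ∧ G ∈ Ext M (insert F C) ↔
      (F ∈ Ext M C ∧ G ∈ Ext M C) ∧ (F ⊂ G ∨ G ⊂ F) := by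
  constructor
  · rintro ⟨hF, hG⟩
    have hcmp := ext_cmp hG (Finset.mem_insert_self F C)
    refine ⟨⟨hF, mem_Ext.2 ⟨fun h => (mem_Ext.1 hG).1 (Finset.mem_insert_of_mem h), ?_⟩⟩, hcmp⟩
    refine hC.insert_of (ext_flat hG) ?_
    intro D hD
    rcases ext_cmp hG (Finset.mem_insert_of_mem hD) with h | h
    · exact Or.inl h.subset
    · exact Or.inr h.subset
  · rintro ⟨⟨hF, hG⟩, h⟩
    refine ⟨hF, mem_Ext.2 ⟨?_, ?_⟩⟩
    · intro hm
      rcases Finset.mem_insert.1 hm with rfl | hm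
      · rcases h with h | h <;> exact (ssubset_irrefl _ h)
      · exact (mem_Ext.1 hG).1 hm
    · refine (ext_ch hF).insert_of (ext_flat hG) ?_
      intro D hD
      rcases Finset.mem_insert.1 hD with rfl | hD
      · rcases h with h | h
        · exact Or.inl h.subset
        · exact Or.inr h.subset
      · rcases ext_cmp hG hD with h | h
        · exact Or.inl h.subset
        · exact Or.inr h.subset

lemma mem_ext_ext' {C : Finset (Finset E)} (hC : IsCh M C) {F G : Finset E} :
    F ∈ Ext M C ∧ G ∈ Ext M (insert F C) ↔ F ∈ Ext M (insert G C) ∧ G ∈ Ext M C := by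
  rw [mem_ext_ext hC, and_comm (a := F ∈ Ext M (insert G C)), mem_ext_ext hC]
  tauto

end Part1

section Part2

variable {E : Type*} [Fintype E] [DecidableEq E] {M : FlatSys E}

/-- smallest member of the chain containing `e` -/
noncomputable def up (C : Finset (Finset E)) (e : E) : Finset E := (C.filter (fun D => e ∈ D)).inf id

/-- largest member of the chain not containing `e` -/
noncomputable def dn (C : Finset (Finset E)) (e : E) : Finset E := (C.filter (fun D => e ∉ D)).sup id

/-- the linear function interpolating `t` on the chain -/
noncomputable def Lin (C : Finset (Finset E)) (t : Finset E → ℝ) (e : E) : ℝ :=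
  (t (up C e) - t (dn C e)) / ((up C e).card - (dn C e).card)

/-- the normalization of `t` relative to the chain -/
noncomputable def N (C : Finset (Finset E)) (t : Finset E → ℝ) (F : Finset E) : ℝ :=
  t F - t ∅ - ∑ e ∈ F, Lin C t e

/-- the mixed degree polynomial -/
noncomputable def Vf (M : FlatSys E) : List (Finset E → ℝ) → Finset (Finset E) → ℝ
  | [], _ => 1
  | t :: ts, C => ∑ F ∈ Ext M C, N C t F * Vf M ts (insert F C)

lemma Gap.up_eq {C : Finset (Finset E)} {A B : Finset E} (h : Gap C A B) {e : E}
    (he : e ∈ B) (he' : e ∉ A) : up C e = B := by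
  apply le_antisymm
  · exact Finset.inf_le (f := id) (by simp [h.2.1, he])
  · refine Finset.le_inf ?_
    intro D hD
    simp only [Finset.mem_filter] at hD
    rcases h.2.2.2 D hD.1 with h1 | h1
    · exact absurd (h1 hD.2) he'
    · exact h1

lemma Gap.dn_eq {C : Finset (Finset E)} {A B : Finset E} (h : Gap C A B) {e : E}
    (he : e ∈ B) (he' : e ∉ A) : dn C e = A := by
  apply le_antisymm
  · refine Finset.sup_le ?_
    intro D hD
    simp only [Finset.mem_filter] at hD
    rcases h.2.2.2 D hD.1 with h1 | h1
    · exact h1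
    · exact absurd (h1 he) hD.2
  · exact Finset.le_sup (f := id) (by simp [h.1, he'])

lemma Gap.Lin_sum {C : Finset (Finset E)} {A B F : Finset E} (h : Gap C A B) (t : Finset E → ℝ)
    (h1 : A ⊆ F) (h2 : F ⊆ B) :
    ∑ e ∈ F, Lin C t e = ∑ e ∈ A, Lin C t e +
      ((F.card : ℝ) - A.card) * ((t B - t A) / ((B.card : ℝ) - A.card)) := by
  rw [← Finset.sum_sdiff h1, add_comm]
  congr 1
  rw [Finset.sum_congr rfl (g := fun _ => (t B - t A) / ((B.card : ℝ) - A.card))]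
  · rw [Finset.sum_const, nsmul_eq_mul, Finset.card_sdiff_of_subset h1,
      Nat.cast_sub (Finset.card_le_card h1)]
  · intro e he
    rw [Finset.mem_sdiff] at he
    rw [Lin, h.up_eq (h2 he.1) he.2, h.dn_eq (h2 he.1) he.2]

lemma IsCh.Lin_sum {C : Finset (Finset E)} (hC : IsCh M C) (t : Finset E → ℝ) :
    ∀ (n : ℕ) (F : Finset E), F ∈ C → F.card = n → ∑ e ∈ F, Lin C t e = t F - t ∅ := by
  intro n
  induction n using Nat.strong_induction_on with
  | _ n ih =>
    intro F hF hn
    by_cases hne : F = ∅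
    · subst hne; simp
    · obtain ⟨A, hg⟩ := hC.gap_below hF hne
      have hlt := Finset.card_lt_card hg.2.2.1
      rw [hg.Lin_sum t hg.2.2.1.subset subset_rfl, ih A.card (hn ▸ hlt) A hg.1 rfl]
      have : (F.card : ℝ) - A.card ≠ 0 := by
        have : (A.card : ℝ) < F.card := by exact_mod_cast hlt
        linarith
      field_simp
      ring

lemma IsCh.N_zero {C : Finset (Finset E)} (hC : IsCh M C) (t : Finset E → ℝ) {F : Finset E}
    (hF : F ∈ C) : N C t F = 0 := by
  rw [N, hC.Lin_sum t _ F hF rfl]; ring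

lemma Gap.N_eq {C : Finset (Finset E)} (hC : IsCh M C) {A B F : Finset E} (h : Gap C A B)
    (t : Finset E → ℝ) (h1 : A ⊆ F) (h2 : F ⊆ B) :
    N C t F = t F - t A -
      ((F.card : ℝ) - A.card) * ((t B - t A) / ((B.card : ℝ) - A.card)) := by
  rw [N, h.Lin_sum t h1 h2, hC.Lin_sum t _ A h.1 rfl]; ring

/-- `t'` differs from `t` by an affine function -/
def AffEq (t t' : Finset E → ℝ) : Prop :=
  ∃ (c : ℝ) (a : E → ℝ), ∀ F, t' F = t F - c - ∑ e ∈ F, a e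

lemma affEq_N (C : Finset (Finset E)) (t : Finset E → ℝ) : AffEq t (N C t) :=
  ⟨t ∅, Lin C t, fun _ => rfl⟩

lemma exists_u {C : Finset (Finset E)} (hC : IsCh M C) {F : Finset E} (hF : F ∈ Ext M C) :
    ∃ u : E → ℝ, (∀ D ∈ C, ∑ e ∈ D, u e = 0) ∧ ∑ e ∈ F, u e = 1 := by
  have hne : ∅ ≠ F := by rintro rfl; exact (mem_Ext.1 hF).1 hC.2.2.1
  refine ⟨Lin (insert F C) (Pi.single F 1), ?_, ?_⟩
  · intro D hD
    have hDF : D ≠ F := by rintro rfl; exact (mem_Ext.1 hF).1 hD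
    rw [(ext_ch hF).Lin_sum _ _ D (Finset.mem_insert_of_mem hD) rfl]
    simp [hDF, hne]
  · rw [(ext_ch hF).Lin_sum _ _ F (Finset.mem_insert_self _ _) rfl]
    simp [hne]

/-- Balancing statement for a fixed list. -/
def Bal (M : FlatSys E) (ts : List (Finset E → ℝ)) : Prop :=
  ∀ C, IsCh M C → C.card + ts.length = M.r → ∀ b : E → ℝ, (∀ F ∈ C, ∑ e ∈ F, b e = 0) →
    ∑ F ∈ Ext M C, (∑ e ∈ F, b e) * Vf M ts (insert F C) = 0

lemma Bal.inv {ts : List (Finset E → ℝ)} (h : Bal M ts) {C : Finset (Finset E)} (hC : IsCh M C)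
    (hl : C.card + ts.length = M.r) {t t' : Finset E → ℝ} (ht : AffEq t t')
    (h0 : ∀ F ∈ C, t' F = 0) :
    Vf M (t :: ts) C = ∑ F ∈ Ext M C, t' F * Vf M ts (insert F C) := by
  obtain ⟨c, a, hta⟩ := ht
  have hc : t ∅ = c := by
    have h1 := h0 ∅ hC.2.2.1
    rw [hta] at h1
    simp at h1
    linarith
  have hb := h C hC hl (fun e => a e - Lin C t e) (by
    intro F hF
    have h1 := h0 F hF
    have h2 := hC.N_zero t hF
    rw [hta] at h1
    rw [N] at h2
    rw [Finset.sum_sub_distrib]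
    linarith)
  rw [Vf, ← sub_eq_zero, ← Finset.sum_sub_distrib, ← hb]
  refine Finset.sum_congr rfl ?_
  intro F hF
  rw [Finset.sum_sub_distrib, hta, N, hc]
  ring

/-- two step formula -/
lemma Bal.inv2 {ts : List (Finset E → ℝ)} (h : Bal M ts) {C : Finset (Finset E)}
    (hl : C.card + 1 + ts.length = M.r) {t t' : Finset E → ℝ} (ht : AffEq t t')
    (h0 : ∀ F ∈ C, t' F = 0) {F : Finset E} (hF : F ∈ Ext M C) {u : E → ℝ}
    (hu : ∀ D ∈ C, ∑ e ∈ D, u e = 0) (hu1 : ∑ e ∈ F, u e = 1) :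
    Vf M (t :: ts) (insert F C) = ∑ G ∈ Ext M (insert F C), (t' G - t' F * ∑ e ∈ G, u e) *
      Vf M ts (insert G (insert F C)) := by
  refine h.inv (ext_ch hF) (by rw [ext_card hF]; omega)
    (t' := fun G => t' G - t' F * ∑ e ∈ G, u e) ?_ ?_
  · obtain ⟨c, a, hta⟩ := ht
    refine ⟨c, fun e => a e + t' F * u e, ?_⟩
    intro G
    simp only
    rw [hta G, Finset.sum_add_distrib, Finset.mul_sum]
    ring
  · intro G hG
    rcases Finset.mem_insert.1 hG with rfl | hG
    · rw [hu1]; ring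
    · rw [hu G hG, h0 G hG]; ring

lemma sum_ext_comm {C : Finset (Finset E)} (hC : IsCh M C) (f : Finset E → Finset E → ℝ) :
    ∑ F ∈ Ext M C, ∑ G ∈ Ext M (insert F C), f F G =
      ∑ F ∈ Ext M C, ∑ G ∈ Ext M (insert F C), f G F := by
  refine Finset.sum_comm' ?_
  intro F G
  exact mem_ext_ext' hC

lemma bal_nil : Bal M [] := by
  intro C hC hl b hb
  have hm : (miss M C).card = 1 := by
    have := hC.card_miss
    simp at hl
    omega
  obtain ⟨k, hk⟩ := Finset.card_eq_one.1 hm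
  have hkm : k ∈ miss M C := by rw [hk]; simp
  obtain ⟨A, B, hg, h1, h2⟩ := hC.gap hkm
  have hrA : M.rk A + 1 = k := by
    by_contra hne
    have : M.rk A + 1 ∉ miss M C := by rw [hk, Finset.mem_singleton]; exact hne
    rw [mem_miss] at this
    push Not at this
    obtain ⟨D, hD, hDr⟩ := this (by have := rk_le_r (hC.1 B hg.2.1); omega)
    rcases hg.2.2.2 D hD with h | h
    · have := rk_mono (hC.1 D hD) (hC.1 A hg.1) h; omega
    · have := rk_mono (hC.1 B hg.2.1) (hC.1 D hD) h; omega
  have hAF : ∀ F ∈ Ext M C, A ⊂ F ∧ F ⊂ B := by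
    intro F hF
    have hr := ext_miss hF
    rw [hk, Finset.mem_singleton] at hr
    exact ⟨(ext_ch hF).ssub (Finset.mem_insert_of_mem hg.1) (Finset.mem_insert_self _ _) (by omega),
      (ext_ch hF).ssub (Finset.mem_insert_self _ _) (Finset.mem_insert_of_mem hg.2.1) (by omega)⟩
  have key : ∀ F ∈ Ext M C, (∑ e ∈ F, b e) * Vf M [] (insert F C) =
      ∑ e ∈ B \ A, if e ∈ F then b e else 0 := by
    intro F hF
    rw [Vf, mul_one, ← Finset.sum_sdiff (hAF F hF).1.subset, hb A hg.1, add_zero,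
      ← Finset.sum_filter]
    refine Finset.sum_congr ?_ (fun _ _ => rfl)
    ext e
    have hs : F ⊆ B := (hAF F hF).2.subset
    have := @hs e
    simp only [Finset.mem_sdiff, Finset.mem_filter]
    tauto
  rw [Finset.sum_congr rfl key, Finset.sum_comm]
  have key2 : ∀ e ∈ B \ A, (∑ F ∈ Ext M C, if e ∈ F then b e else 0) = b e := by
    intro e he
    rw [Finset.mem_sdiff] at he
    obtain ⟨G, hG, hAG, hGB, heG, hrG, hmin⟩ := hg.cover hC (by omega) he.1 he.2
    rw [Finset.sum_eq_single G]
    · simp [heG]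
    · intro F hF hne
      have : e ∉ F := by
        intro heF
        apply hne
        have h3 := hmin F (ext_flat hF) (hAF F hF).1.subset heF
        have hr := ext_miss hF
        rw [hk, Finset.mem_singleton] at hr
        exact (eq_of_rk (ext_flat hG) (ext_flat hF) h3 (by omega)).symm
      simp [this]
    · intro h; exact absurd hG h
  rw [Finset.sum_congr rfl key2]
  have h3 := Finset.sum_sdiff hg.2.2.1.subset (f := b)
  rw [hb A hg.1, hb B hg.2.1] at h3
  linarith

theorem bal (ts : List (Finset E → ℝ)) : Bal M ts := by
  induction ts with
  | nil => exact bal_nil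
  | cons s ss ih =>
    intro C hC hl b hb
    simp only [List.length_cons] at hl
    have hu : ∀ F : Finset E, ∃ u : E → ℝ, F ∈ Ext M C →
        (∀ D ∈ C, ∑ e ∈ D, u e = 0) ∧ ∑ e ∈ F, u e = 1 := by
      intro F
      by_cases hF : F ∈ Ext M C
      · obtain ⟨u, h1⟩ := exists_u hC hF
        exact ⟨u, fun _ => h1⟩
      · exact ⟨0, fun h => absurd h hF⟩
    choose u hu using hu
    set s' := N C s with hs'
    have e1 : ∀ F ∈ Ext M C, (∑ e ∈ F, b e) * Vf M (s :: ss) (insert F C) =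
        (∑ G ∈ Ext M (insert F C), (∑ e ∈ F, b e) * s' G * Vf M ss (insert G (insert F C))) -
        (∑ G ∈ Ext M (insert F C), (∑ e ∈ F, b e) * s' F * (∑ e ∈ G, u F e) *
          Vf M ss (insert G (insert F C))) := by
      intro F hF
      rw [ih.inv2 (by omega) (affEq_N C s) (fun F hF => hC.N_zero s hF) hF (hu F hF).1 (hu F hF).2,
        ← Finset.sum_sub_distrib, Finset.mul_sum]
      refine Finset.sum_congr rfl (fun G _ => ?_)
      rw [← hs']
      ring
    rw [Finset.sum_congr rfl e1, Finset.sum_sub_distrib, sum_ext_comm hC, ← Finset.sum_sub_distrib]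
    refine Finset.sum_eq_zero ?_
    intro F hF
    rw [← Finset.sum_sub_distrib]
    have h1 := ih (insert F C) (ext_ch hF) (by rw [ext_card hF]; omega)
      (fun e => b e - (∑ e ∈ F, b e) * u F e) (by
        intro D hD
        rw [Finset.sum_sub_distrib, ← Finset.mul_sum]
        rcases Finset.mem_insert.1 hD with rfl | hD
        · rw [(hu D hF).2]; ring
        · rw [(hu F hF).1 D hD, hb D hD]; ring)
    have h2 : ∑ G ∈ Ext M (insert F C), s' F * ((∑ e ∈ G, (b e - (∑ e ∈ F, b e) * u F e)) *
        Vf M ss (insert G (insert F C))) = 0 := by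
      rw [← Finset.mul_sum, h1, mul_zero]
    rw [← h2]
    refine Finset.sum_congr rfl (fun G _ => ?_)
    rw [Finset.sum_sub_distrib, ← Finset.mul_sum, Finset.insert_comm]
    ring

/-- matrix of the Hessian -/
theorem Vf_two {C : Finset (Finset E)} (hC : IsCh M C) {ts : List (Finset E → ℝ)}
    (hl : C.card + 1 + ts.length = M.r) {s t s' t' : Finset E → ℝ} (hs : AffEq s s')
    (hs0 : ∀ F ∈ C, s' F = 0) (ht : AffEq t t') (ht0 : ∀ F ∈ C, t' F = 0)
    {u : Finset E → E → ℝ} (hu : ∀ F ∈ Ext M C, ∀ D ∈ C, ∑ e ∈ D, u F e = 0)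
    (hu1 : ∀ F ∈ Ext M C, ∑ e ∈ F, u F e = 1) :
    Vf M (s :: t :: ts) C =
      (∑ F ∈ Ext M C, ∑ G ∈ Ext M (insert F C), s' F * t' G * Vf M ts (insert G (insert F C))) -
      ∑ F ∈ Ext M C, s' F * t' F * ∑ G ∈ Ext M (insert F C), (∑ e ∈ G, u F e) *
          Vf M ts (insert G (insert F C)) := by
  rw [(bal (t :: ts)).inv hC (by simp only [List.length_cons]; omega) hs hs0,
    ← Finset.sum_sub_distrib]
  refine Finset.sum_congr rfl (fun F hF => ?_)
  rw [(bal ts).inv2 hl ht ht0 hF (hu F hF) (hu1 F hF), Finset.mul_sum, Finset.mul_sum,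
    ← Finset.sum_sub_distrib]
  refine Finset.sum_congr rfl (fun G _ => ?_)
  ring

lemma exists_us {C : Finset (Finset E)} (hC : IsCh M C) :
    ∃ u : Finset E → E → ℝ, (∀ F ∈ Ext M C, ∀ D ∈ C, ∑ e ∈ D, u F e = 0) ∧
      (∀ F ∈ Ext M C, ∑ e ∈ F, u F e = 1) := by
  have hu : ∀ F : Finset E, ∃ u : E → ℝ, F ∈ Ext M C →
        (∀ D ∈ C, ∑ e ∈ D, u e = 0) ∧ ∑ e ∈ F, u e = 1 := by
    intro F
    by_cases hF : F ∈ Ext M C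
    · obtain ⟨u, h1⟩ := exists_u hC hF
      exact ⟨u, fun _ => h1⟩
    · exact ⟨0, fun h => absurd h hF⟩
  choose u hu using hu
  exact ⟨u, fun F hF => (hu F hF).1, fun F hF => (hu F hF).2⟩

theorem Vf_swap {C : Finset (Finset E)} (hC : IsCh M C) {ts : List (Finset E → ℝ)}
    (hl : C.card + 1 + ts.length = M.r) (s t : Finset E → ℝ) :
    Vf M (s :: t :: ts) C = Vf M (t :: s :: ts) C := by
  obtain ⟨u, hu, hu1⟩ := exists_us hC
  rw [Vf_two hC hl (affEq_N C s) (fun _ h => hC.N_zero s h) (affEq_N C t)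
    (fun _ h => hC.N_zero t h) hu hu1,
    Vf_two hC hl (affEq_N C t) (fun _ h => hC.N_zero t h) (affEq_N C s)
    (fun _ h => hC.N_zero s h) hu hu1, sum_ext_comm hC]
  congr 1
  · refine Finset.sum_congr rfl (fun F _ => Finset.sum_congr rfl (fun G _ => ?_))
    rw [Finset.insert_comm]; ring
  · refine Finset.sum_congr rfl (fun F _ => ?_)
    ring

theorem Vf_perm {l l' : List (Finset E → ℝ)} (h : l.Perm l') :
    ∀ {C : Finset (Finset E)}, IsCh M C → C.card + l.length = M.r + 1 → Vf M l C = Vf M l' C := by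
  induction h with
  | nil => intros; rfl
  | cons x _ ih =>
    intro C hC hl
    simp only [List.length_cons] at hl
    rw [Vf, Vf]
    refine Finset.sum_congr rfl (fun F hF => ?_)
    rw [ih (ext_ch hF) (by rw [ext_card hF]; omega)]
  | swap x y l =>
    intro C hC hl
    simp only [List.length_cons] at hl
    exact Vf_swap hC (by omega) y x
  | trans h1 _ ih1 ih2 =>
    intro C hC hl
    rw [ih1 hC hl, ih2 hC (by rw [← h1.length_eq]; exact hl)]

lemma N_lin (C : Finset (Finset E)) (s t : Finset E → ℝ) (c : ℝ) (F : Finset E) :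
    N C (s + c • t) F = N C s F + c * N C t F := by
  have : ∑ e ∈ F, Lin C (s + c • t) e = ∑ e ∈ F, Lin C s e + c * ∑ e ∈ F, Lin C t e := by
    rw [Finset.mul_sum, ← Finset.sum_add_distrib]
    refine Finset.sum_congr rfl (fun e _ => ?_)
    simp only [Lin, Pi.add_apply, Pi.smul_apply, smul_eq_mul]
    ring
  rw [N, this, N, N]
  simp only [Pi.add_apply, Pi.smul_apply, smul_eq_mul]
  ring

lemma Vf_lin (C : Finset (Finset E)) (s t : Finset E → ℝ) (c : ℝ) (l : List (Finset E → ℝ)) :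
    Vf M ((s + c • t) :: l) C = Vf M (s :: l) C + c * Vf M (t :: l) C := by
  simp only [Vf, N_lin, add_mul, Finset.sum_add_distrib, Finset.mul_sum, mul_assoc]

lemma Vf_quad {C : Finset (Finset E)} (hC : IsCh M C) {ts : List (Finset E → ℝ)}
    (hl : C.card + 1 + ts.length = M.r) (s t : Finset E → ℝ) (c : ℝ) :
    Vf M ((s + c • t) :: (s + c • t) :: ts) C =
      Vf M (s :: s :: ts) C + 2 * c * Vf M (s :: t :: ts) C + c ^ 2 * Vf M (t :: t :: ts) C := by
  rw [Vf_lin, Vf_swap hC hl s, Vf_swap hC hl t, Vf_lin, Vf_lin, Vf_swap hC hl t s]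
  ring

end Part2

section Part3


lemma spectral_fun {ι : Type*} [Fintype ι] (A : ι → ι → ℝ) (hA : ∀ i j, A i j = A j i) :
    ∃ (U : ι → ι → ℝ) (l : ι → ℝ), (∀ k i, ∑ j, A i j * U k j = l k * U k i) ∧
      (∀ k k', ∑ i, U k i * U k' i = if k = k' then 1 else 0) ∧
      (∀ y : ι → ℝ, ∑ i, y i * ∑ j, A i j * y j = ∑ k, l k * (∑ i, U k i * y i) ^ 2) := by
  have hH : (Matrix.of A).IsHermitian := by
    ext i j
    simp [Matrix.conjTranspose_apply, hA i j]
  have hev : ∀ k i, ∑ j, A i j * hH.eigenvectorBasis k j =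
      hH.eigenvalues k * hH.eigenvectorBasis k i := by
    intro k i
    have := congrFun (hH.mulVec_eigenvectorBasis k) i
    simpa [Matrix.mulVec, dotProduct] using this
  have hin : ∀ (k : ι) (z : ι → ℝ), inner ℝ (WithLp.toLp 2 z : EuclideanSpace ℝ ι)
      (hH.eigenvectorBasis k) = ∑ i, hH.eigenvectorBasis k i * z i := by
    intro k z
    simp [PiLp.inner_apply, mul_comm]
  refine ⟨fun k i => hH.eigenvectorBasis k i, hH.eigenvalues, hev, ?_, ?_⟩
  · intro k k'
    have := orthonormal_iff_ite.1 hH.eigenvectorBasis.orthonormal k k'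
    rw [← this]
    simp [PiLp.inner_apply, mul_comm]
  · intro y
    have h := hH.eigenvectorBasis.sum_inner_mul_inner (WithLp.toLp 2 y)
      (WithLp.toLp 2 (fun i => ∑ j, A i j * y j))
    have h2 : inner ℝ (WithLp.toLp 2 y : EuclideanSpace ℝ ι)
      (WithLp.toLp 2 (fun i => ∑ j, A i j * y j)) = ∑ i, y i * ∑ j, A i j * y j := by
      simp [PiLp.inner_apply, mul_comm]
    rw [← h2, ← h]
    refine Finset.sum_congr rfl (fun k _ => ?_)
    rw [real_inner_comm _ (hH.eigenvectorBasis k), hin, hin]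
    have h3 : ∑ i, hH.eigenvectorBasis k i * ∑ j, A i j * y j =
        hH.eigenvalues k * ∑ i, hH.eigenvectorBasis k i * y i := by
      simp only [Finset.mul_sum]
      rw [Finset.sum_comm]
      refine Finset.sum_congr rfl (fun j _ => ?_)
      rw [← mul_assoc, ← hev k j, Finset.sum_mul]
      refine Finset.sum_congr rfl (fun i _ => ?_)
      rw [hA j i]; ring
    rw [h3]; ring

lemma pf_identity {ι : Type*} [Fintype ι] (m : ι → ι → ℝ) (hm : ∀ i j, m i j = m j i)
    (v p x : ι → ℝ) (hv : ∀ i, 0 < v i) (hmv : ∀ i, ∑ j, m i j * v j = p i) :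
    ∑ i, ∑ j, m i j * v i * v j * (x i / v i - x j / v j) ^ 2 =
      2 * (∑ i, p i / v i * x i ^ 2) - 2 * ∑ i, x i * ∑ j, m i j * x j := by
  have e : ∀ i j, m i j * v i * v j * (x i / v i - x j / v j) ^ 2 =
      m i j * v j * (x i ^ 2 / v i) + m j i * v i * (x j ^ 2 / v j) - 2 * (x i * (m i j * x j)) := by
    intro i j
    have h1 := (hv i).ne'
    have h2 := (hv j).ne'
    rw [hm j i]
    field_simp
    ring
  simp only [e, Finset.sum_sub_distrib, Finset.sum_add_distrib]
  have h1 : ∑ i, ∑ j, m i j * v j * (x i ^ 2 / v i) = ∑ i, p i / v i * x i ^ 2 := by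
    refine Finset.sum_congr rfl (fun i _ => ?_)
    rw [← Finset.sum_mul, hmv]; ring
  rw [Finset.sum_comm (f := fun i j => m j i * v i * (x j ^ 2 / v j)), h1]
  simp only [← Finset.mul_sum]
  ring

lemma eig_lemma {ι : Type*} [Fintype ι] (m : ι → ι → ℝ) (hm : ∀ i j, m i j = m j i)
    (hoff : ∀ i j, i ≠ j → 0 ≤ m i j) (v p : ι → ℝ) (hv : ∀ i, 0 < v i) (hp : ∀ i, 0 < p i)
    (hmv : ∀ i, ∑ j, m i j * v j = p i)
    (hB : ∀ x : ι → ℝ, ∑ i, x i * ∑ j, m i j * x j ≤ ∑ i, v i * (∑ j, m i j * x j) ^ 2 / p i)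
    (hconn : ∀ φ : ι → ℝ, (∀ i j, i ≠ j → 0 < m i j → φ i = φ j) → ∀ i j, φ i = φ j)
    (l : ℝ) (x : ι → ℝ) (hx : x ≠ 0) (hl : ∀ i, ∑ j, m i j * x j = l * (p i / v i) * x i)
    (hpos : 0 < l) : l = 1 ∧ ∀ i j, x i / v i = x j / v j := by
  have hS : 0 < ∑ i, p i / v i * x i ^ 2 := by
    obtain ⟨i, hi⟩ := Function.ne_iff.1 hx
    refine Finset.sum_pos' (fun i _ => ?_) ⟨i, Finset.mem_univ i, ?_⟩
    · have := hv i; have := hp i; positivity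
    · have := hv i; have := hp i
      have : x i ≠ 0 := hi
      positivity
  have hQ : ∑ i, x i * ∑ j, m i j * x j = l * ∑ i, p i / v i * x i ^ 2 := by
    rw [Finset.mul_sum]
    refine Finset.sum_congr rfl (fun i _ => ?_)
    rw [hl]; ring
  have hQ2 : ∑ i, v i * (∑ j, m i j * x j) ^ 2 / p i = l ^ 2 * ∑ i, p i / v i * x i ^ 2 := by
    rw [Finset.mul_sum]
    refine Finset.sum_congr rfl (fun i _ => ?_)
    rw [hl]
    have := (hv i).ne'; have := (hp i).ne'
    field_simp
  have h1 := hB x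
  rw [hQ, hQ2] at h1
  have h2 := pf_identity m hm v p x hv hmv
  rw [hQ] at h2
  have hnn : ∀ i j, 0 ≤ m i j * v i * v j * (x i / v i - x j / v j) ^ 2 := by
    intro i j
    by_cases h : i = j
    · subst h; simp
    · have := hoff i j h; have := hv i; have := hv j
      positivity
  have h3 : 0 ≤ ∑ i, ∑ j, m i j * v i * v j * (x i / v i - x j / v j) ^ 2 :=
    Finset.sum_nonneg (fun i _ => Finset.sum_nonneg (fun j _ => hnn i j))
  set S := ∑ i, p i / v i * x i ^ 2
  have hle : l ≤ 1 := by
    by_contra h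
    push Not at h
    nlinarith
  have hge : 1 ≤ l := by
    by_contra h
    push Not at h
    have : l * S * (1 - l) > 0 := by
      have : 0 < 1 - l := by linarith
      positivity
    nlinarith
  have hl1 : l = 1 := le_antisymm hle hge
  refine ⟨hl1, hconn (fun i => x i / v i) ?_⟩
  intro i j hij hmij
  rw [hl1] at h2
  have h4 : ∑ i, ∑ j, m i j * v i * v j * (x i / v i - x j / v j) ^ 2 = 0 := by
    rw [h2]; ring
  rw [Finset.sum_eq_zero_iff_of_nonneg (fun i _ => Finset.sum_nonneg (fun j _ => hnn i j))] at h4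
  have h5 := h4 i (Finset.mem_univ i)
  rw [Finset.sum_eq_zero_iff_of_nonneg (fun j _ => hnn i j)] at h5
  have h6 := h5 j (Finset.mem_univ j)
  have h7 : m i j * v i * v j ≠ 0 := by
    have := hv i; have := hv j
    positivity
  have h8 := (mul_eq_zero.1 h6).resolve_left h7
  have := pow_eq_zero_iff (two_ne_zero) |>.1 h8
  linarith

theorem la_main {ι : Type*} [Fintype ι] (m : ι → ι → ℝ) (hm : ∀ i j, m i j = m j i)
    (hoff : ∀ i j, i ≠ j → 0 ≤ m i j) (v p : ι → ℝ) (hv : ∀ i, 0 < v i) (hp : ∀ i, 0 < p i)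
    (hmv : ∀ i, ∑ j, m i j * v j = p i)
    (hB : ∀ x : ι → ℝ, ∑ i, x i * ∑ j, m i j * x j ≤ ∑ i, v i * (∑ j, m i j * x j) ^ 2 / p i)
    (hconn : ∀ φ : ι → ℝ, (∀ i j, i ≠ j → 0 < m i j → φ i = φ j) → ∀ i j, φ i = φ j)
    (x : ι → ℝ) :
    (∑ i, x i * ∑ j, m i j * x j) * (∑ i, v i * p i) ≤ (∑ i, x i * p i) ^ 2 := by
  set d : ι → ℝ := fun i => Real.sqrt (p i / v i) with hd
  have hd0 : ∀ i, 0 < d i := fun i => Real.sqrt_pos.2 (div_pos (hp i) (hv i))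
  have hd2 : ∀ i, d i * d i = p i / v i := fun i =>
    Real.mul_self_sqrt (div_pos (hp i) (hv i)).le
  obtain ⟨U, l, hU1, hU2, hU3⟩ := spectral_fun (fun i j => m i j / (d i * d j))
    (fun i j => by rw [hm i j, mul_comm])
  -- eigenvectors
  have hx : ∀ k, (fun i => U k i / d i) ≠ 0 := by
    intro k h
    have h1 := hU2 k k
    have h2 : ∀ i, U k i = 0 := by
      intro i
      have := congrFun h i
      simp only [Pi.zero_apply, div_eq_zero_iff] at this
      exact this.resolve_right (hd0 i).ne'
    simp [h2] at h1
  have hev : ∀ k i, ∑ j, m i j * (U k j / d j) = l k * (p i / v i) * (U k i / d i) := by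
    intro k i
    have h1 := hU1 k i
    have h2 : ∑ j, m i j * (U k j / d j) = d i * ∑ j, m i j / (d i * d j) * U k j := by
      rw [Finset.mul_sum]
      refine Finset.sum_congr rfl (fun j _ => ?_)
      have := (hd0 i).ne'; have := (hd0 j).ne'
      field_simp
    rw [h2, h1, ← hd2 i]
    have := (hd0 i).ne'
    field_simp
  have hcase := fun k hk => eig_lemma m hm hoff v p hv hp hmv hB hconn (l k) _ (hx k) (hev k) hk
  have hprop : ∀ k, 0 < l k → ∃ c : ℝ, ∀ i, U k i = c * (d i * v i) := by
    intro k hk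
    obtain ⟨i0, hi0⟩ := Function.ne_iff.1 (hx k)
    refine ⟨U k i0 / d i0 / v i0, fun i => ?_⟩
    have h1 := (hcase k hk).2 i0 i
    rw [h1]
    have := (hd0 i).ne'; have := (hv i).ne'
    field_simp
  have hW : ∑ i, (d i * v i) * (d i * v i) = ∑ i, v i * p i := by
    refine Finset.sum_congr rfl (fun i _ => ?_)
    rw [show d i * v i * (d i * v i) = (d i * d i) * v i * v i by ring, hd2]
    have := (hv i).ne'
    field_simp
  have hvp : 0 ≤ ∑ i, v i * p i := Finset.sum_nonneg (fun i _ => (mul_pos (hv i) (hp i)).le)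
  have hQ : ∑ i, x i * ∑ j, m i j * x j = ∑ k, l k * (∑ i, U k i * (d i * x i)) ^ 2 := by
    rw [← hU3 (fun i => d i * x i)]
    refine Finset.sum_congr rfl (fun i _ => ?_)
    rw [Finset.mul_sum, Finset.mul_sum]
    refine Finset.sum_congr rfl (fun j _ => ?_)
    have := (hd0 i).ne'; have := (hd0 j).ne'
    field_simp
  rw [hQ]
  by_cases hex : ∃ k, 0 < l k
  · obtain ⟨k, hk⟩ := hex
    obtain ⟨c, hc⟩ := hprop k hk
    have hcc : c * c * ∑ i, v i * p i = 1 := by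
      have := hU2 k k
      simp only [hc, if_true] at this
      rw [← hW, ← this, Finset.mul_sum]
      refine Finset.sum_congr rfl (fun i _ => ?_)
      ring
    have hle : ∑ k, l k * (∑ i, U k i * (d i * x i)) ^ 2 ≤ (∑ i, U k i * (d i * x i)) ^ 2 := by
      rw [← Finset.add_sum_erase _ _ (Finset.mem_univ k), (hcase k hk).1, one_mul]
      have : ∑ k' ∈ Finset.univ.erase k, l k' * (∑ i, U k' i * (d i * x i)) ^ 2 ≤ 0 := by
        refine Finset.sum_nonpos (fun k' hk' => ?_)
        have hne := Finset.ne_of_mem_erase hk'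
        have hl' : l k' ≤ 0 := by
          by_contra hcon
          push Not at hcon
          obtain ⟨c', hc'⟩ := hprop k' hcon
          have h1 := hU2 k' k'
          have h2 := hU2 k' k
          rw [if_neg hne] at h2
          rw [if_pos rfl] at h1
          have h3 : ∑ i, U k' i * U k i = c' * c * ∑ i, v i * p i := by
            rw [← hW, Finset.mul_sum]
            refine Finset.sum_congr rfl (fun i _ => ?_)
            rw [hc, hc']; ring
          have h4 : ∑ i, U k' i * U k' i = c' * c' * ∑ i, v i * p i := by
            rw [← hW, Finset.mul_sum]
            refine Finset.sum_congr rfl (fun i _ => ?_)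
            rw [hc']; ring
          rw [h3] at h2
          rw [h4] at h1
          have hc0 : c ≠ 0 := by rintro rfl; simp at hcc
          have hc0' : c' ≠ 0 := by rintro rfl; simp at h1
          have hs0 : ∑ i, v i * p i ≠ 0 := by intro h; rw [h] at h1; simp at h1
          exact (mul_ne_zero (mul_ne_zero hc0' hc0) hs0) h2
        exact mul_nonpos_of_nonpos_of_nonneg hl' (sq_nonneg _)
      linarith
    have h5 : ∑ i, U k i * (d i * x i) = c * ∑ i, x i * p i := by
      rw [Finset.mul_sum]
      refine Finset.sum_congr rfl (fun i _ => ?_)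
      rw [hc, show c * (d i * v i) * (d i * x i) = c * ((d i * d i) * v i * x i) by ring, hd2]
      have := (hv i).ne'
      field_simp
    calc _ ≤ (∑ i, U k i * (d i * x i)) ^ 2 * ∑ i, v i * p i :=
          mul_le_mul_of_nonneg_right hle hvp
      _ = (c * c * ∑ i, v i * p i) * (∑ i, x i * p i) ^ 2 := by rw [h5]; ring
      _ = _ := by rw [hcc, one_mul]
  · push Not at hex
    have : ∑ k, l k * (∑ i, U k i * (d i * x i)) ^ 2 ≤ 0 :=
      Finset.sum_nonpos (fun k _ => mul_nonpos_of_nonpos_of_nonneg (hex k) (sq_nonneg _))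
    nlinarith [sq_nonneg (∑ i, x i * p i)]

end Part3

section Part4

variable {E : Type*} [Fintype E] [DecidableEq E] {M : FlatSys E}

/-- the (strict) cone -/
def Cn (t : Finset E → ℝ) : Prop := ∀ A F B : Finset E, A ⊂ F → F ⊂ B →
  ((B.card : ℝ) - F.card) * t A + ((F.card : ℝ) - A.card) * t B < ((B.card : ℝ) - A.card) * t F

lemma N_pos {C : Finset (Finset E)} (hC : IsCh M C) {t : Finset E → ℝ} (ht : Cn t) {F : Finset E}
    (hF : F ∈ Ext M C) : 0 < N C t F := by
  obtain ⟨A, B, hg, h1, h2⟩ := ext_gap hC hF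
  rw [hg.N_eq hC t h1.subset h2.subset]
  have h3 := ht A F B h1 h2
  have h4 : (A.card : ℝ) < F.card := by exact_mod_cast Finset.card_lt_card h1
  have h5 : (F.card : ℝ) < B.card := by exact_mod_cast Finset.card_lt_card h2
  have h6 : (0 : ℝ) < (B.card : ℝ) - A.card := by linarith
  have h7 : t F - t A - ((F.card : ℝ) - A.card) * ((t B - t A) / ((B.card : ℝ) - A.card)) =
    (((B.card : ℝ) - A.card) * t F - (((B.card : ℝ) - F.card) * t A +
      ((F.card : ℝ) - A.card) * t B)) / ((B.card : ℝ) - A.card) := by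
    field_simp
    ring
  rw [h7]
  exact div_pos (by linarith) h6

theorem Vf_pos (ts : List (Finset E → ℝ)) (hts : ∀ t ∈ ts, Cn t) :
    ∀ C, IsCh M C → C.card + ts.length = M.r + 1 → 0 < Vf M ts C := by
  induction ts with
  | nil => intros; simp [Vf]
  | cons t ts ih =>
    intro C hC hl
    simp only [List.length_cons] at hl
    rw [Vf]
    refine Finset.sum_pos (fun F hF => ?_) (hC.ext_nonempty (by omega))
    refine mul_pos (N_pos hC (hts t (by simp)) hF) ?_
    exact ih (fun s hs => hts s (by simp [hs])) _ (ext_ch hF) (by rw [ext_card hF]; omega)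

lemma Gap.miss {C : Finset (Finset E)} (hC : IsCh M C) {A B : Finset E} (h : Gap C A B) {i : ℕ}
    (h1 : M.rk A < i) (h2 : i < M.rk B) : i ∈ miss M C := by
  rw [mem_miss]
  refine ⟨?_, ?_⟩
  · have := rk_le_r (hC.1 B h.2.1); omega
  · intro D hD hr
    rcases h.2.2.2 D hD with h3 | h3
    · have := rk_mono (hC.1 D hD) (hC.1 A h.1) h3; omega
    · have := rk_mono (hC.1 B h.2.1) (hC.1 D hD) h3; omega

/-- the line through two points -/
lemma exists_line {A B p q : Finset E} (hA : M.IsFlat A) (hB : M.IsFlat B) (hp : M.IsFlat p)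
    (hq : M.IsFlat q) (hAp : A ⊆ p) (hAq : A ⊆ q) (hpB : p ⊆ B) (hqB : q ⊆ B)
    (hrp : M.rk p = M.rk A + 1) (hrq : M.rk q = M.rk A + 1) (hne : p ≠ q) :
    ∃ l, M.IsFlat l ∧ p ⊆ l ∧ q ⊆ l ∧ l ⊆ B ∧ M.rk l = M.rk A + 2 ∧
      ∀ D, M.IsFlat D → p ⊆ D → q ⊆ D → l ⊆ D := by
  have : ¬ q ⊆ p := fun h => hne (eq_of_rk hq hp h (by omega)).symm
  obtain ⟨e, heq, hep⟩ := Finset.not_subset.1 this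
  obtain ⟨l, h1, h2, h3, h4, h5⟩ := M.cover p e hp hep
  obtain ⟨q', g1, g2, g3, g4, g5⟩ := M.cover A e hA (fun h => hep (hAp h))
  have hqq : q' = q := eq_of_rk g1 hq (g5 q hq hAq heq) (by omega)
  refine ⟨l, h1, h2, ?_, h5 B hB hpB (hqB heq), by omega, ?_⟩
  · rw [← hqq]; exact g5 l h1 (hAp.trans h2) h3
  · intro D hD hpD hqD
    exact h5 D hD hpD (hqD heq)

lemma ssub_of_rk {A B : Finset E} (h : A ⊆ B) (hr : M.rk A ≠ M.rk B) : A ⊂ B :=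
  h.ssubset_of_ne (by rintro rfl; exact hr rfl)

theorem ext_connected {C : Finset (Finset E)} (hC : IsCh M C) (h2 : C.card + 2 ≤ M.r + 1)
    (φ : Finset E → ℝ) (hφ : ∀ F ∈ Ext M C, ∀ G ∈ Ext M C, F ⊂ G → φ F = φ G) :
    ∀ F ∈ Ext M C, ∀ G ∈ Ext M C, φ F = φ G := by
  have hcm : 1 < (miss M C).card := by have := hC.card_miss; omega
  have hne : (miss M C).Nonempty := Finset.card_pos.1 (by omega)
  obtain ⟨k, hk, hmin⟩ := Finset.exists_min_image (miss M C) id hne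
  simp only [id] at hmin
  obtain ⟨k', hk', hkk⟩ := Finset.exists_mem_ne hcm k
  obtain ⟨A, B, hg, hkA, hkB⟩ := hC.gap hk
  have hA := hC.1 A hg.1
  have hB := hC.1 B hg.2.1
  have step1 : ∀ F ∈ Ext M C, ∃ p ∈ Ext M C, A ⊂ p ∧ p ⊂ B ∧ M.rk p = M.rk A + 1 ∧ φ F = φ p := by
    intro F hF
    rcases hg.mid hF with h | h | h
    · have h3 := hmin _ (ext_miss hF)
      have := rk_mono (ext_flat hF) hA h.subset
      omega
    · obtain ⟨e, he, he'⟩ := Finset.exists_of_ssubset h.1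
      obtain ⟨p, hp, h4, h5, h6, h7, h8⟩ := hg.cover hC (by omega) (h.2.subset he) he'
      refine ⟨p, hp, h4, h5, h7, ?_⟩
      rcases (h8 F (ext_flat hF) h.1.subset he).eq_or_ssubset with h9 | h9
      · rw [h9]
      · exact (hφ p hp F hF h9).symm
    · obtain ⟨e, he, he'⟩ := hg.exists_mem
      obtain ⟨p, hp, h4, h5, h6, h7, h8⟩ := hg.cover hC (by omega) he he'
      exact ⟨p, hp, h4, h5, h7, (hφ p hp F hF (h5.trans h)).symm⟩
  have step2 : ∀ p ∈ Ext M C, ∀ q ∈ Ext M C, A ⊂ p → p ⊂ B → A ⊂ q → q ⊂ B →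
      M.rk p = M.rk A + 1 → M.rk q = M.rk A + 1 → φ p = φ q := by
    intro p hp q hq hAp hpB hAq hqB hrp hrq
    by_cases hpq : p = q
    · rw [hpq]
    by_cases hrB : M.rk A + 2 < M.rk B
    · obtain ⟨l, g1, g2, g3, g4, g5, g6⟩ := exists_line hA hB (ext_flat hp) (ext_flat hq) hAp.subset
        hAq.subset hpB.subset hqB.subset hrp hrq hpq
      have hpl : p ⊂ l := ssub_of_rk (M := M) g2 (by omega)
      have hql : q ⊂ l := ssub_of_rk (M := M) g3 (by omega)
      have hlB : l ⊂ B := ssub_of_rk (M := M) g4 (by omega)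
      have hl : l ∈ Ext M C := hg.mem_ext hC g1 (hAp.trans hpl) hlB
      rw [hφ p hp l hl hpl, hφ q hq l hl hql]
    · obtain ⟨A', B', hg', h3, h4⟩ := hC.gap hk'
      have h5 := hmin k' hk'
      have h6 := (mem_miss.1 hk').2 B hg.2.1
      have hBA : B ⊆ A' := by
        rcases hg'.2.2.2 B hg.2.1 with h | h
        · exact h
        · have := rk_mono (hC.1 B' hg'.2.1) hB h
          omega
      obtain ⟨e, he, he'⟩ := hg'.exists_mem
      obtain ⟨G, hG, h7, -⟩ := hg'.cover hC (by omega) he he'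
      have hBG : B ⊂ G := lt_of_le_of_lt hBA h7
      rw [hφ p hp G hG (hpB.trans hBG), hφ q hq G hG (hqB.trans hBG)]
  intro F hF G hG
  obtain ⟨p, hp, a1, a2, a3, a4⟩ := step1 F hF
  obtain ⟨q, hq, b1, b2, b3, b4⟩ := step1 G hG
  rw [a4, b4]
  exact step2 p hp q hq a1 a2 b1 b2 a3 b3

/-- elementary quadratic inequality -/
lemma quad_aux {a b c s s' : ℝ} (hb : 0 < b) (hs : s' ≠ 0)
    (h : a * s' ^ 2 - 2 * c * s * s' + b * s ^ 2 ≤ 0) : a * b ≤ c ^ 2 := by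
  have h1 : (c ^ 2 - a * b) * s' ^ 2 =
      (b * s - c * s') ^ 2 - b * (a * s' ^ 2 - 2 * c * s * s' + b * s ^ 2) := by ring
  have h2 : 0 ≤ (c ^ 2 - a * b) * s' ^ 2 := by
    rw [h1]
    nlinarith [sq_nonneg (b * s - c * s')]
  have h3 : 0 < s' ^ 2 := by positivity
  have := nonneg_of_mul_nonneg_left h2 h3
  linarith

/-- change of the reference vector -/
lemma change_v {C : Finset (Finset E)} (hC : IsCh M C) {ts : List (Finset E → ℝ)}
    (hl : C.card + 1 + ts.length = M.r) {v0 v : Finset E → ℝ}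
    (h0 : 0 < Vf M (v0 :: v0 :: ts) C) (hv : 0 < Vf M (v :: v :: ts) C)
    (h : ∀ x, Vf M (x :: x :: ts) C * Vf M (v0 :: v0 :: ts) C ≤ (Vf M (x :: v0 :: ts) C) ^ 2)
    (x : Finset E → ℝ) :
    Vf M (x :: x :: ts) C * Vf M (v :: v :: ts) C ≤ (Vf M (x :: v :: ts) C) ^ 2 := by
  have hvv : Vf M (v :: v0 :: ts) C ≠ 0 := by
    intro h1
    have := h v
    rw [h1] at this
    nlinarith [mul_pos hv h0]
  set c := -(Vf M (x :: v0 :: ts) C / Vf M (v :: v0 :: ts) C) with hc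
  have h1 := h (x + c • v)
  rw [Vf_lin C x v c (v0 :: ts), Vf_quad hC hl] at h1
  have h2 : Vf M (x :: v0 :: ts) C + c * Vf M (v :: v0 :: ts) C = 0 := by
    rw [hc]; field_simp; ring
  rw [h2] at h1
  have h3 : Vf M (x :: x :: ts) C + 2 * c * Vf M (x :: v :: ts) C + c ^ 2 * Vf M (v :: v :: ts) C
      ≤ 0 := by
    by_contra hcon
    push Not at hcon
    nlinarith [mul_pos hcon h0]
  refine quad_aux (s := -c) (s' := 1) hv one_ne_zero ?_
  nlinarith

lemma base_row {C : Finset (Finset E)} (hl : C.card + 1 = M.r)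
    {A B F : Finset E} (hg : Gap C A B) (hF : F ∈ Ext M C) (hFB : F ⊂ B)
    {e1 e2 : E} (h1 : e1 ∈ F) (h1' : e1 ∉ A) (h2 : e2 ∈ B) (h2' : e2 ∉ F) (hAF : A ⊂ F)
    {y y' : Finset E → ℝ} (hy : AffEq y y') (hy0 : ∀ F ∈ C, y' F = 0) :
    Vf M [y] (insert F C) = ∑ G ∈ Ext M (insert F C),
      (y' G - y' F * ((if e1 ∈ G then 1 else 0) - (if e2 ∈ G then 1 else 0))) := by
  have hu : ∀ D : Finset E, ∑ e ∈ D, ((if e = e1 then (1 : ℝ) else 0) - (if e = e2 then 1 else 0)) =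
      (if e1 ∈ D then 1 else 0) - (if e2 ∈ D then 1 else 0) := by
    intro D
    rw [Finset.sum_sub_distrib, Finset.sum_ite_eq', Finset.sum_ite_eq']
  rw [(bal []).inv2 (by simpa using hl) hy hy0 hF
    (u := fun e => (if e = e1 then (1 : ℝ) else 0) - (if e = e2 then 1 else 0))]
  · simp only [hu, Vf, mul_one]
  · intro D hD
    rw [hu]
    rcases hg.2.2.2 D hD with h | h
    · rw [if_neg (fun h3 => h1' (h h3)), if_neg (fun h3 => h2' (hAF.subset (h h3)))]; ring
    · rw [if_pos (h (hFB.subset h1)), if_pos (h h2)]; ring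
  · rw [hu, if_pos h1, if_neg h2']; ring

theorem HR_base {C : Finset (Finset E)} (hC : IsCh M C) (hl : C.card + 1 = M.r)
    {v : Finset E → ℝ} (hv : 0 < Vf M [v, v] C) (x : Finset E → ℝ) :
    Vf M [x, x] C * Vf M [v, v] C ≤ (Vf M [x, v] C) ^ 2 := by
  have hcm : (miss M C).card = 2 := by have := hC.card_miss; omega
  obtain ⟨j, k, hjk, hm⟩ : ∃ j k, j < k ∧ miss M C = {j, k} := by
    obtain ⟨a, b, hab, h⟩ := Finset.card_eq_two.1 hcm
    rcases lt_or_gt_of_ne hab with h1 | h1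
    · exact ⟨a, b, h1, h⟩
    · exact ⟨b, a, h1, by rw [h, Finset.pair_comm]⟩
  have hmem : ∀ i, i ∈ miss M C ↔ i = j ∨ i = k := by intro i; rw [hm]; simp
  obtain ⟨A, B, hg, hA1, hB1⟩ := hC.gap ((hmem j).2 (Or.inl rfl))
  have hA := hC.1 A hg.1
  have hB := hC.1 B hg.2.1
  have hrA : M.rk A + 1 = j := by
    rcases (hmem _).1 (hg.miss hC (i := M.rk A + 1) (by omega) (by omega)) with h | h <;> omega
  set P := (Ext M C).filter (fun F => M.rk F = j) with hP
  set Q := (Ext M C).filter (fun F => M.rk F = k) with hQ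
  have hrk : ∀ F ∈ Ext M C, M.rk F = j ∨ M.rk F = k := fun F hF => (hmem _).1 (ext_miss hF)
  have hsplit : ∀ f : Finset E → ℝ, ∑ F ∈ Ext M C, f F = ∑ F ∈ P, f F + ∑ F ∈ Q, f F := by
    intro f
    rw [← Finset.sum_filter_add_sum_filter_not (Ext M C) (fun F => M.rk F = j)]
    congr 1
    refine Finset.sum_congr ?_ (fun _ _ => rfl)
    ext F
    simp only [hQ, Finset.mem_filter]
    constructor
    · rintro ⟨h1, h2⟩; exact ⟨h1, (hrk F h1).resolve_left h2⟩
    · rintro ⟨h1, h2⟩; exact ⟨h1, by omega⟩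
  have hlt : ∀ F ∈ Ext M C, ∀ G ∈ Ext M C, F ⊂ G → M.rk F = j ∧ M.rk G = k := by
    intro F hF G hG h
    have := M.rk_lt F G (ext_flat hF) (ext_flat hG) h
    have := hrk F hF
    have := hrk G hG
    omega
  have hEP : ∀ p ∈ P, Ext M (insert p C) = Q.filter (fun l => p ⊂ l) := by
    intro p hp
    rw [hP, Finset.mem_filter] at hp
    ext G
    have h1 := mem_ext_ext hC (F := p) (G := G)
    simp only [hQ, Finset.mem_filter]
    constructor
    · intro hG
      obtain ⟨⟨-, h3⟩, h4⟩ := h1.1 ⟨hp.1, hG⟩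
      rcases h4 with h4 | h4
      · exact ⟨⟨h3, (hlt p hp.1 G h3 h4).2⟩, h4⟩
      · have := (hlt G h3 p hp.1 h4).2; omega
    · rintro ⟨⟨h3, -⟩, h4⟩
      exact (h1.2 ⟨⟨hp.1, h3⟩, Or.inl h4⟩).2
  have hEQ : ∀ l ∈ Q, Ext M (insert l C) = P.filter (fun p => p ⊂ l) := by
    intro l hl
    rw [hQ, Finset.mem_filter] at hl
    ext G
    have h1 := mem_ext_ext hC (F := l) (G := G)
    simp only [hP, Finset.mem_filter]
    constructor
    · intro hG
      obtain ⟨⟨-, h3⟩, h4⟩ := h1.1 ⟨hl.1, hG⟩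
      rcases h4 with h4 | h4
      · have := (hlt l hl.1 G h3 h4).1; omega
      · exact ⟨⟨h3, (hlt G h3 l hl.1 h4).1⟩, h4⟩
    · rintro ⟨⟨h3, -⟩, h4⟩
      exact (h1.2 ⟨⟨hl.1, h3⟩, Or.inr h4⟩).2
  have hAP : ∀ p ∈ P, A ⊂ p ∧ p ⊂ B := by
    intro p hp
    rw [hP, Finset.mem_filter] at hp
    exact ⟨(ext_ch hp.1).ssub (Finset.mem_insert_of_mem hg.1) (Finset.mem_insert_self _ _)
      (by omega), (ext_ch hp.1).ssub (Finset.mem_insert_self _ _) (Finset.mem_insert_of_mem hg.2.1)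
      (by omega)⟩
  have hPE : ∀ p ∈ P, p ∈ Ext M C := fun p hp => (Finset.mem_filter.1 hp).1
  have hQE : ∀ p ∈ Q, p ∈ Ext M C := fun p hp => (Finset.mem_filter.1 hp).1
  have hPr : ∀ p ∈ P, M.rk p = j := fun p hp => (Finset.mem_filter.1 hp).2
  have hQr : ∀ p ∈ Q, M.rk p = k := fun p hp => (Finset.mem_filter.1 hp).2
  by_cases hkB : k < M.rk B
  · -- one gap of rank three
    have hkj : k = j + 1 := by
      rcases (hmem _).1 (hg.miss hC (i := j + 1) (by omega) (by omega)) with h | h <;> omega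
    have hAQ : ∀ l ∈ Q, A ⊂ l ∧ l ⊂ B := by
      intro p hp
      rw [hQ, Finset.mem_filter] at hp
      exact ⟨(ext_ch hp.1).ssub (Finset.mem_insert_of_mem hg.1) (Finset.mem_insert_self _ _)
        (by omega), (ext_ch hp.1).ssub (Finset.mem_insert_self _ _)
        (Finset.mem_insert_of_mem hg.2.1) (by omega)⟩
    -- rows
    have rowQ : ∀ (y : Finset E → ℝ), ∀ l ∈ Q, Vf M [y] (insert l C) =
        ∑ p ∈ P, (if p ⊂ l then 1 else 0) * N C y p - N C y l := by
      intro y l hl'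
      obtain ⟨e1, h1, h1'⟩ := Finset.exists_of_ssubset (hAQ l hl').1
      obtain ⟨e2, h2, h2'⟩ := Finset.exists_of_ssubset (hAQ l hl').2
      rw [base_row hl hg (hQE l hl') (hAQ l hl').2 h1 h1' h2 h2' (hAQ l hl').1 (affEq_N C y)
        (fun F hF => hC.N_zero y hF), hEQ l hl', Finset.sum_sub_distrib, Finset.sum_filter]
      congr 1
      · refine Finset.sum_congr rfl (fun p _ => ?_)
        split_ifs <;> ring
      · rw [← Finset.mul_sum]
        have : ∑ p ∈ P with p ⊂ l, ((if e1 ∈ p then (1 : ℝ) else 0) - if e2 ∈ p then 1 else 0)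
            = 1 := by
          obtain ⟨p0, hp0, g1, g2, g3, g4, g5⟩ := hg.cover hC (by omega)
            ((hAQ l hl').2.subset h1) h1'
          rw [Finset.sum_eq_single p0]
          · have : e2 ∉ p0 := fun h => h2' (g5 l (ext_flat (hQE l hl')) (hAQ l hl').1.subset h1 h)
            simp [g3, this]
          · intro p hp hne
            rw [Finset.mem_filter] at hp
            have e1p : e1 ∉ p := by
              intro h
              exact hne (eq_of_rk (ext_flat hp0) (ext_flat (hPE p hp.1))
                (g5 p (ext_flat (hPE p hp.1)) (hAP p hp.1).1.subset h)
                (by rw [hPr p hp.1]; omega)).symm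
            have e2p : e2 ∉ p := fun h => h2' (hp.2.subset h)
            simp [e1p, e2p]
          · intro h
            exfalso
            apply h
            rw [Finset.mem_filter, hP, Finset.mem_filter]
            refine ⟨⟨hp0, by omega⟩, ?_⟩
            refine ssub_of_rk (M := M) (g5 l (ext_flat (hQE l hl')) (hAQ l hl').1.subset h1) ?_
            rw [hQr l hl']; omega
        rw [this]; ring
    have rowP : ∀ (y : Finset E → ℝ), ∀ p ∈ P, Vf M [y] (insert p C) =
        ∑ l ∈ Q, (if p ⊂ l then 1 else 0) * N C y l -
          (∑ l ∈ Q, (if p ⊂ l then 1 else 0) - 1) * N C y p := by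
      intro y p hp'
      obtain ⟨e1, h1, h1'⟩ := Finset.exists_of_ssubset (hAP p hp').1
      obtain ⟨e2, h2, h2'⟩ := Finset.exists_of_ssubset (hAP p hp').2
      rw [base_row hl hg (hPE p hp') (hAP p hp').2 h1 h1' h2 h2' (hAP p hp').1 (affEq_N C y)
        (fun F hF => hC.N_zero y hF), hEP p hp', Finset.sum_sub_distrib, Finset.sum_filter]
      congr 1
      · refine Finset.sum_congr rfl (fun p _ => ?_)
        split_ifs <;> ring
      · rw [← Finset.mul_sum, mul_comm]
        congr 1
        rw [Finset.sum_sub_distrib]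
        congr 1
        · rw [Finset.sum_filter]
          refine Finset.sum_congr rfl (fun l hl' => ?_)
          by_cases h : p ⊂ l
          · simp [h, h.subset h1]
          · simp [h]
        · obtain ⟨l0, g1, g2, g3, g4, g5⟩ := M.cover p e2 (ext_flat (hPE p hp')) h2'
          have hp0 := hPr p hp'
          have hpl : p ⊂ l0 := ssub_of_rk (M := M) g2 (by omega)
          have hlB : l0 ⊂ B := ssub_of_rk (M := M) (g5 B hB (hAP p hp').2.subset h2) (by omega)
          rw [Finset.sum_eq_single l0]
          · simp [g3]
          · intro l hl' hne
            rw [Finset.mem_filter] at hl'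
            have : e2 ∉ l := by
              intro h
              exact hne (eq_of_rk g1 (ext_flat (hQE l hl'.1))
                (g5 l (ext_flat (hQE l hl'.1)) hl'.2.subset h)
                (by rw [hQr l hl'.1]; omega)).symm
            simp [this]
          · intro h
            exfalso
            apply h
            rw [Finset.mem_filter, hQ, Finset.mem_filter]
            exact ⟨⟨hg.mem_ext hC g1 ((hAP p hp').1.trans hpl) hlB, by omega⟩, hpl⟩
    -- two points determine a line
    have hcount : ∀ p ∈ P, ∀ q ∈ P, ∑ l ∈ Q, (if p ⊂ l then (1 : ℝ) else 0) *
        (if q ⊂ l then 1 else 0) =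
        1 + if p = q then (∑ l ∈ Q, (if p ⊂ l then (1 : ℝ) else 0) - 1) else 0 := by
      intro p hp q hq
      by_cases hpq : p = q
      · subst hpq
        rw [if_pos rfl, add_sub_cancel]
        exact Finset.sum_congr rfl (fun l _ => by split_ifs <;> simp)
      · have rp := hPr p hp
        have rq := hPr q hq
        obtain ⟨l0, g1, g2, g3, g4, g5, g6⟩ := exists_line hA hB (ext_flat (hPE p hp))
          (ext_flat (hPE q hq)) (hAP p hp).1.subset (hAP q hq).1.subset (hAP p hp).2.subset
          (hAP q hq).2.subset (by omega) (by omega) hpq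
        have hpl : p ⊂ l0 := ssub_of_rk (M := M) g2 (by omega)
        have hql : q ⊂ l0 := ssub_of_rk (M := M) g3 (by omega)
        have hlB : l0 ⊂ B := ssub_of_rk (M := M) g4 (by omega)
        rw [Finset.sum_eq_single l0]
        · simp [hpl, hql, hpq]
        · intro l hl' hne
          by_contra hcon
          have h1 : p ⊂ l := by by_contra h; simp [h] at hcon
          have h2 : q ⊂ l := by by_contra h; simp [h] at hcon
          exact hne (eq_of_rk g1 (ext_flat (hQE l hl'))
                (g6 l (ext_flat (hQE l hl')) h1.subset h2.subset)
                (by rw [hQr l hl']; omega)).symm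
        · intro h
          exfalso
          apply h
          rw [hQ, Finset.mem_filter]
          exact ⟨hg.mem_ext hC g1 ((hAP p hp).1.trans hpl) hlB, by omega⟩
    set I : Finset E → Finset E → ℝ := fun p l => if p ⊂ l then 1 else 0 with hI
    set S : (Finset E → ℝ) → ℝ := fun y => ∑ p ∈ P, N C y p with hS
    set Z : (Finset E → ℝ) → Finset E → ℝ := fun y l => N C y l - ∑ p ∈ P, I p l * N C y p with hZ
    have form : ∀ y z : Finset E → ℝ, Vf M [y, z] C = S y * S z - ∑ l ∈ Q, Z y l * Z z l := by
      intro y z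
      have e0 : Vf M [y, z] C = ∑ F ∈ Ext M C, N C y F * Vf M [z] (insert F C) := rfl
      rw [e0, hsplit, Finset.sum_congr rfl (fun p hp => by rw [rowP z p hp]),
        Finset.sum_congr (s₁ := Q) rfl (fun p hp => by rw [rowQ z p hp])]
      have e1 : ∑ l ∈ Q, (∑ p ∈ P, I p l * N C y p) * (∑ q ∈ P, I q l * N C z q) =
          S y * S z + ∑ p ∈ P, (∑ l ∈ Q, I p l - 1) * (N C y p * N C z p) := by
        calc _ = ∑ l ∈ Q, ∑ p ∈ P, ∑ q ∈ P, (N C y p * N C z q) * (I p l * I q l) := by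
              refine Finset.sum_congr rfl (fun l _ => ?_)
              rw [Finset.sum_mul_sum]
              refine Finset.sum_congr rfl (fun p _ => Finset.sum_congr rfl (fun q _ => ?_))
              ring
          _ = ∑ p ∈ P, ∑ q ∈ P, (N C y p * N C z q) * ∑ l ∈ Q, (I p l * I q l) := by
              rw [Finset.sum_comm]
              refine Finset.sum_congr rfl (fun p _ => ?_)
              rw [Finset.sum_comm]
              refine Finset.sum_congr rfl (fun q _ => ?_)
              rw [Finset.mul_sum]
          _ = ∑ p ∈ P, ∑ q ∈ P, ((N C y p * N C z q) +
                if p = q then (∑ l ∈ Q, I p l - 1) * (N C y p * N C z q) else 0) := by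
              refine Finset.sum_congr rfl (fun p hp => Finset.sum_congr rfl (fun q hq => ?_))
              rw [hcount p hp q hq]
              split_ifs <;> ring
          _ = _ := by
              simp only [Finset.sum_add_distrib]
              congr 1
              · rw [hS, Finset.sum_mul_sum]
              · refine Finset.sum_congr rfl (fun p hp => ?_)
                rw [Finset.sum_ite_eq, if_pos hp]
      have e2 : ∑ l ∈ Q, Z y l * Z z l = ∑ l ∈ Q, N C y l * N C z l -
          ∑ l ∈ Q, N C y l * (∑ p ∈ P, I p l * N C z p) -
          ∑ l ∈ Q, (∑ p ∈ P, I p l * N C y p) * N C z l +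
          ∑ l ∈ Q, (∑ p ∈ P, I p l * N C y p) * (∑ q ∈ P, I q l * N C z q) := by
        rw [← Finset.sum_sub_distrib, ← Finset.sum_sub_distrib, ← Finset.sum_add_distrib]
        refine Finset.sum_congr rfl (fun l _ => ?_)
        simp only [hZ]
        ring
      have e3 : ∑ l ∈ Q, (∑ p ∈ P, I p l * N C y p) * N C z l =
          ∑ p ∈ P, N C y p * ∑ l ∈ Q, I p l * N C z l := by
        simp only [Finset.sum_mul, Finset.mul_sum]
        rw [Finset.sum_comm]
        refine Finset.sum_congr rfl (fun p _ => Finset.sum_congr rfl (fun l _ => ?_))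
        ring
      rw [e2, e1, e3]
      simp only [mul_sub, Finset.sum_sub_distrib]
      have e4 : ∑ p ∈ P, N C y p * ((∑ l ∈ Q, I p l - 1) * N C z p) =
          ∑ p ∈ P, (∑ l ∈ Q, I p l - 1) * (N C y p * N C z p) :=
        Finset.sum_congr rfl (fun p _ => by ring)
      simp only [hI] at e4 ⊢
      rw [e4]
      ring
    have hSv : S v ≠ 0 := by
      intro h
      rw [form, h] at hv
      have : 0 ≤ ∑ l ∈ Q, Z v l * Z v l := Finset.sum_nonneg (fun l _ => mul_self_nonneg _)
      linarith
    refine quad_aux (s := S x) (s' := S v) hv hSv ?_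
    have h1 : Vf M [x, x] C * S v ^ 2 - 2 * Vf M [x, v] C * S x * S v + Vf M [v, v] C * S x ^ 2 =
        - ∑ l ∈ Q, (S v * Z x l - S x * Z v l) ^ 2 := by
      have e5 : ∀ a b : ℝ, ∑ l ∈ Q, (a * Z x l - b * Z v l) ^ 2 = a ^ 2 * ∑ l ∈ Q, Z x l * Z x l -
          2 * a * b * ∑ l ∈ Q, Z x l * Z v l + b ^ 2 * ∑ l ∈ Q, Z v l * Z v l := by
        intro a b
        rw [Finset.mul_sum, Finset.mul_sum, Finset.mul_sum, ← Finset.sum_sub_distrib,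
          ← Finset.sum_add_distrib]
        exact Finset.sum_congr rfl (fun l _ => by ring)
      rw [e5, form, form, form]
      ring
    rw [h1, neg_nonpos]
    exact Finset.sum_nonneg (fun l _ => sq_nonneg _)
  · -- two gaps of rank two
    have hkB' : M.rk B < k := by
      have := (mem_miss.1 ((hmem k).2 (Or.inr rfl))).2 B hg.2.1
      omega
    obtain ⟨A', B', hg', hA1', hB1'⟩ := hC.gap ((hmem k).2 (Or.inr rfl))
    have hBA : B ⊆ A' := by
      rcases hg'.2.2.2 B hg.2.1 with h | h
      · exact h
      · have := rk_mono (hC.1 B' hg'.2.1) hB h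
        omega
    have hAQ : ∀ l ∈ Q, A' ⊂ l ∧ l ⊂ B' := by
      intro p hp
      rw [hQ, Finset.mem_filter] at hp
      exact ⟨(ext_ch hp.1).ssub (Finset.mem_insert_of_mem hg'.1) (Finset.mem_insert_self _ _)
        (by omega), (ext_ch hp.1).ssub (Finset.mem_insert_self _ _)
        (Finset.mem_insert_of_mem hg'.2.1) (by omega)⟩
    have hPQ : ∀ p ∈ P, ∀ l ∈ Q, p ⊂ l := fun p hp l hl =>
      ((hAP p hp).2.trans_subset hBA).trans (hAQ l hl).1
    have rowP : ∀ (y : Finset E → ℝ), ∀ p ∈ P, Vf M [y] (insert p C) = ∑ l ∈ Q, N C y l := by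
      intro y p hp'
      obtain ⟨e1, h1, h1'⟩ := Finset.exists_of_ssubset (hAP p hp').1
      obtain ⟨e2, h2, h2'⟩ := Finset.exists_of_ssubset (hAP p hp').2
      rw [base_row hl hg (hPE p hp') (hAP p hp').2 h1 h1' h2 h2' (hAP p hp').1 (affEq_N C y)
        (fun F hF => hC.N_zero y hF), hEP p hp', Finset.filter_true_of_mem (hPQ p hp')]
      refine Finset.sum_congr rfl (fun l hl' => ?_)
      rw [if_pos ((hPQ p hp' l hl').subset h1), if_pos ((hAQ l hl').1.subset (hBA h2))]
      ring
    have rowQ : ∀ (y : Finset E → ℝ), ∀ l ∈ Q, Vf M [y] (insert l C) = ∑ p ∈ P, N C y p := by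
      intro y l hl'
      obtain ⟨e1, h1, h1'⟩ := Finset.exists_of_ssubset (hAQ l hl').1
      obtain ⟨e2, h2, h2'⟩ := Finset.exists_of_ssubset (hAQ l hl').2
      rw [base_row hl hg' (hQE l hl') (hAQ l hl').2 h1 h1' h2 h2' (hAQ l hl').1 (affEq_N C y)
        (fun F hF => hC.N_zero y hF), hEQ l hl', Finset.filter_true_of_mem
        (fun p hp => hPQ p hp l hl')]
      refine Finset.sum_congr rfl (fun p hp => ?_)
      rw [if_neg (fun h => h1' (hBA ((hAP p hp).2.subset h))),
        if_neg (fun h => h2' ((hPQ p hp l hl').subset h))]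
      ring
    have form : ∀ y z : Finset E → ℝ, Vf M [y, z] C =
        (∑ p ∈ P, N C y p) * (∑ l ∈ Q, N C z l) + (∑ l ∈ Q, N C y l) * (∑ p ∈ P, N C z p) := by
      intro y z
      have e0 : Vf M [y, z] C = ∑ F ∈ Ext M C, N C y F * Vf M [z] (insert F C) := rfl
      have eP : ∑ p ∈ P, N C y p * Vf M [z] (insert p C) = ∑ p ∈ P, N C y p * ∑ l ∈ Q, N C z l :=
        Finset.sum_congr rfl (fun p hp => by rw [rowP z p hp])
      have eQ : ∑ l ∈ Q, N C y l * Vf M [z] (insert l C) = ∑ l ∈ Q, N C y l * ∑ p ∈ P, N C z p :=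
        Finset.sum_congr rfl (fun l hl' => by rw [rowQ z l hl'])
      rw [e0, hsplit, eP, eQ, ← Finset.sum_mul, ← Finset.sum_mul]
    rw [form, form, form]
    nlinarith [sq_nonneg ((∑ p ∈ P, N C x p) * (∑ l ∈ Q, N C v l) -
      (∑ l ∈ Q, N C x l) * (∑ p ∈ P, N C v p))]

end Part4

section Part5

variable {E : Type*} [Fintype E] [DecidableEq E] {M : FlatSys E}

lemma affEq_refl (t : Finset E → ℝ) : AffEq t t := ⟨0, 0, fun F => by simp⟩

lemma ext_sub {C : Finset (Finset E)} (hC : IsCh M C) {F : Finset E} (hF : F ∈ Ext M C) :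
    Ext M (insert F C) ⊆ Ext M C := fun _ hG => ((mem_ext_ext hC).1 ⟨hF, hG⟩).1.2

theorem HR_step {C : Finset (Finset E)} (hC : IsCh M C) {ts : List (Finset E → ℝ)}
    {v0 : Finset E → ℝ} (hl : C.card + 1 + (v0 :: ts).length = M.r)
    (hts : ∀ t ∈ ts, Cn t) (hv0 : Cn v0)
    (ih : ∀ F ∈ Ext M C, ∀ x, Vf M (x :: x :: ts) (insert F C) *
      Vf M (v0 :: v0 :: ts) (insert F C) ≤ (Vf M (x :: v0 :: ts) (insert F C)) ^ 2)
    (x : Finset E → ℝ) :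
    Vf M (x :: x :: v0 :: ts) C * Vf M (v0 :: v0 :: v0 :: ts) C ≤
      (Vf M (x :: v0 :: v0 :: ts) C) ^ 2 := by
  have hl' : C.card + 2 + ts.length = M.r := by simp only [List.length_cons] at hl; omega
  obtain ⟨u, hu, hu1⟩ := exists_us hC
  set W : Finset E → Finset E → ℝ := fun F G => Vf M (v0 :: ts) (insert G (insert F C)) with hW
  have hWs : ∀ F G, W F G = W G F := fun F G => by simp only [hW, Finset.insert_comm]
  set m : Finset E → Finset E → ℝ := fun F G =>
    (if F = G then - ∑ G ∈ Ext M (insert F C), (∑ e ∈ G, u F e) * W F G else 0) +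
    (if G ∈ Ext M (insert F C) then W F G else 0) with hm
  have row : ∀ y y' : Finset E → ℝ, AffEq y y' → (∀ F ∈ C, y' F = 0) → ∀ F ∈ Ext M C,
      ∑ G ∈ Ext M C, m F G * y' G = Vf M (y :: v0 :: ts) (insert F C) := by
    intro y y' hy hy0 F hF
    rw [(bal (v0 :: ts)).inv2 hl hy hy0 hF (hu F hF) (hu1 F hF)]
    simp only [hm, add_mul, Finset.sum_add_distrib, ite_mul, zero_mul, Finset.sum_ite_eq, if_pos hF,
      sub_mul, Finset.sum_sub_distrib]
    rw [← Finset.sum_filter, Finset.filter_mem_eq_inter,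
      Finset.inter_eq_right.2 (ext_sub hC hF), add_comm, sub_eq_add_neg]
    congr 1
    · exact Finset.sum_congr rfl (fun G _ => by simp only [hW]; ring)
    · rw [neg_mul, Finset.sum_mul]
      congr 1
      exact Finset.sum_congr rfl (fun G _ => by simp only [hW]; ring)
  have hWpos : ∀ F ∈ Ext M C, ∀ G ∈ Ext M (insert F C), 0 < W F G := by
    intro F hF G hG
    refine Vf_pos _ ?_ _ (ext_ch hG) ?_
    · intro t ht
      rcases List.mem_cons.1 ht with rfl | ht
      · exact hv0
      · exact hts t ht
    · rw [ext_card hG, ext_card hF]; simp only [List.length_cons]; omega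
  have hp : ∀ F ∈ Ext M C, 0 < Vf M (v0 :: v0 :: ts) (insert F C) := by
    intro F hF
    refine Vf_pos _ ?_ _ (ext_ch hF) ?_
    · intro t ht
      simp only [List.mem_cons] at ht
      rcases ht with rfl | rfl | ht
      · exact hv0
      · exact hv0
      · exact hts t ht
    · rw [ext_card hF]; simp only [List.length_cons]; omega
  have key := la_main (ι := {F // F ∈ Ext M C}) (fun F G => m F.1 G.1) ?_ ?_
    (fun F => N C v0 F.1) (fun F => Vf M (v0 :: v0 :: ts) (insert F.1 C))
    (fun F => N_pos hC hv0 F.2) (fun F => hp F.1 F.2) ?_ ?_ ?_ (fun F => N C x F.1)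
  · have hrow : ∀ F : {F // F ∈ Ext M C}, ∑ G : {F // F ∈ Ext M C}, m F.1 G.1 * N C x G.1 =
        Vf M (x :: v0 :: ts) (insert F.1 C) := by
      intro F
      rw [Finset.sum_coe_sort (Ext M C) (fun G => m F.1 G * N C x G)]
      exact row x _ (affEq_N C x) (fun _ h => hC.N_zero x h) F.1 F.2
    simp only [hrow] at key
    rw [Finset.sum_coe_sort (Ext M C) (fun F => N C x F * Vf M (x :: v0 :: ts) (insert F C)),
      Finset.sum_coe_sort (Ext M C) (fun F => N C v0 F * Vf M (v0 :: v0 :: ts) (insert F C)),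
      Finset.sum_coe_sort (Ext M C) (fun F => N C x F * Vf M (v0 :: v0 :: ts) (insert F C))] at key
    exact key
  · rintro ⟨F, hF⟩ ⟨G, hG⟩
    simp only [hm]
    congr 1
    · by_cases h : F = G
      · subst h; rfl
      · rw [if_neg h, if_neg (Ne.symm h)]
    · have h1 := mem_ext_ext' hC (F := F) (G := G)
      have h2 : G ∈ Ext M (insert F C) ↔ F ∈ Ext M (insert G C) := by tauto
      simp only [h2, hWs F G]
  · rintro ⟨F, hF⟩ ⟨G, hG⟩ hne
    have hne' : F ≠ G := fun h => hne (Subtype.ext h)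
    simp only [hm, if_neg hne', zero_add]
    split_ifs with h
    · exact (hWpos F hF G h).le
    · exact le_rfl
  · rintro ⟨F, hF⟩
    rw [Finset.sum_coe_sort (Ext M C) (fun G => m F G * N C v0 G)]
    exact row v0 _ (affEq_N C v0) (fun _ h => hC.N_zero v0 h) F hF
  · intro y
    set X : Finset E → ℝ := fun F => if h : F ∈ Ext M C then y ⟨F, h⟩ else 0 with hX
    have hXy : ∀ F : {F // F ∈ Ext M C}, y F = X F.1 := fun F => by simp [hX, F.2]
    have hX0 : ∀ F ∈ C, X F = 0 := by
      intro F hF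
      have : F ∉ Ext M C := fun h => (mem_Ext.1 h).1 hF
      simp [hX, this]
    have hrow : ∀ F : {F // F ∈ Ext M C}, ∑ G : {F // F ∈ Ext M C}, m F.1 G.1 * y G =
        Vf M (X :: v0 :: ts) (insert F.1 C) := by
      intro F
      simp only [hXy]
      rw [Finset.sum_coe_sort (Ext M C) (fun G => m F.1 G * X G)]
      exact row X _ (affEq_refl X) hX0 F.1 F.2
    simp only [hrow]
    simp only [hXy]
    rw [Finset.sum_coe_sort (Ext M C) (fun F => X F * Vf M (X :: v0 :: ts) (insert F C)),
      Finset.sum_coe_sort (Ext M C) (fun F => N C v0 F * Vf M (X :: v0 :: ts) (insert F C) ^ 2 /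
        Vf M (v0 :: v0 :: ts) (insert F C)),
      ← (bal (X :: v0 :: ts)).inv hC (by simp only [List.length_cons]; omega) (affEq_refl X) hX0,
      Vf_perm (l' := v0 :: X :: X :: ts) ?_ hC (by simp only [List.length_cons]; omega)]
    · refine Finset.sum_le_sum (fun F hF => ?_)
      rw [mul_div_assoc]
      refine mul_le_mul_of_nonneg_left ?_ (N_pos hC hv0 hF).le
      rw [le_div_iff₀ (hp F hF)]
      exact ih F hF X
    · exact ((List.Perm.swap v0 X ts).cons X).trans (List.Perm.swap v0 X (X :: ts))
  · intro φ hφ F G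
    have := ext_connected hC (by omega) (fun F => if h : F ∈ Ext M C then φ ⟨F, h⟩ else 0) ?_
      F.1 F.2 G.1 G.2
    · simpa [F.2, G.2] using this
    · intro F hF G hG hFG
      simp only [hF, hG, dif_pos]
      have hG' : G ∈ Ext M (insert F C) := ((mem_ext_ext hC).2 ⟨⟨hF, hG⟩, Or.inl hFG⟩).2
      refine hφ _ _ (fun h => hFG.ne (Subtype.ext_iff.1 h)) ?_
      simp only [hm, if_neg hFG.ne, if_pos hG', zero_add]
      exact hWpos F hF G hG'

theorem HR (ts : List (Finset E → ℝ)) (hts : ∀ t ∈ ts, Cn t) : ∀ C, IsCh M C →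
    C.card + 1 + ts.length = M.r → ∀ v, Cn v → ∀ x,
    Vf M (x :: x :: ts) C * Vf M (v :: v :: ts) C ≤ (Vf M (x :: v :: ts) C) ^ 2 := by
  induction ts with
  | nil =>
    intro C hC hl v hv x
    refine HR_base hC (by simpa using hl) (Vf_pos _ ?_ C hC ?_) x
    · simpa using hv
    · simp at hl ⊢; omega
  | cons v0 ts ih =>
    have hv0 := hts v0 (by simp)
    have hts' : ∀ t ∈ ts, Cn t := fun t ht => hts t (by simp [ht])
    intro C hC hl v hv x
    have hl' : C.card + 2 + ts.length = M.r := by simp only [List.length_cons] at hl; omega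
    have hpos : ∀ w : Finset E → ℝ, Cn w → 0 < Vf M (w :: w :: v0 :: ts) C := by
      intro w hw
      refine Vf_pos _ ?_ C hC (by simp only [List.length_cons]; omega)
      intro t ht
      simp only [List.mem_cons] at ht
      rcases ht with rfl | rfl | rfl | ht
      · exact hw
      · exact hw
      · exact hv0
      · exact hts' t ht
    refine change_v hC hl (hpos v0 hv0) (hpos v hv) ?_ x
    refine HR_step hC hl hts' hv0 ?_
    intro F hF
    exact ih hts' (insert F C) (ext_ch hF) (by rw [ext_card hF]; omega) v0 hv0

/-! Passing to the limit. -/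

noncomputable def om : Finset E → ℝ := fun S => - (S.card : ℝ) ^ 2
noncomputable def al : Finset E → ℝ := fun S => if S = Finset.univ then -1 else 0
noncomputable def be : Finset E → ℝ := fun S => if S = ∅ then -1 else 0

lemma Cn_add {t : Finset E → ℝ} (ht : ∀ A F B : Finset E, A ⊂ F → F ⊂ B →
    ((B.card : ℝ) - F.card) * t A + ((F.card : ℝ) - A.card) * t B ≤ ((B.card : ℝ) - A.card) * t F)
    {ε : ℝ} (hε : 0 < ε) : Cn (t + ε • om) := by
  intro A F B h1 h2
  have h4 : (A.card : ℝ) < F.card := by exact_mod_cast Finset.card_lt_card h1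
  have h5 : (F.card : ℝ) < B.card := by exact_mod_cast Finset.card_lt_card h2
  have h6 := ht A F B h1 h2
  simp only [Pi.add_apply, Pi.smul_apply, om, smul_eq_mul]
  have h7 : 0 < ε * (((B.card : ℝ) - F.card) * ((F.card : ℝ) - A.card) * ((B.card : ℝ) - A.card)) :=
    mul_pos hε (mul_pos (mul_pos (by linarith) (by linarith)) (by linarith))
  nlinarith [h7]

lemma Cn_al {ε : ℝ} (hε : 0 < ε) : Cn (al + ε • om : Finset E → ℝ) := by
  refine Cn_add ?_ hε
  intro A F B h1 h2
  have h4 : (A.card : ℝ) < F.card := by exact_mod_cast Finset.card_lt_card h1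
  have hA : A ≠ Finset.univ := fun h => (h ▸ (h1.trans h2)).not_subset (Finset.subset_univ _)
  have hF : F ≠ Finset.univ := fun h => (h ▸ h2).not_subset (Finset.subset_univ _)
  simp only [al, if_neg hA, if_neg hF]
  split_ifs <;> nlinarith

lemma Cn_be {ε : ℝ} (hε : 0 < ε) : Cn (be + ε • om : Finset E → ℝ) := by
  refine Cn_add ?_ hε
  intro A F B h1 h2
  have h4 : (F.card : ℝ) < B.card := by exact_mod_cast Finset.card_lt_card h2
  have hB : B ≠ ∅ := fun h => (h ▸ (h1.trans h2)).not_subset (Finset.empty_subset _)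
  have hF : F ≠ ∅ := fun h => (h ▸ h1).not_subset (Finset.empty_subset _)
  simp only [be, if_neg hB, if_neg hF]
  split_ifs <;> nlinarith

lemma Vf_cont (l : List (Finset E → ℝ)) : ∀ C,
    Continuous (fun ε : ℝ => Vf M (l.map (fun t => t + ε • om)) C) := by
  induction l with
  | nil => intro C; simp only [List.map_nil, Vf]; exact continuous_const
  | cons t l ih =>
    intro C
    simp only [List.map_cons, Vf, N_lin]
    refine continuous_finsetSum _ (fun F _ => ?_)
    exact (continuous_const.add (continuous_id.mul continuous_const)).mul (ih _)

theorem HR_lim {C : Finset (Finset E)} (hC : IsCh M C) (ts : List (Finset E → ℝ))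
    (hts : ∀ t ∈ ts, t = al ∨ t = be) (hl : C.card + 1 + ts.length = M.r) :
    Vf M (al :: al :: ts) C * Vf M (be :: be :: ts) C ≤ (Vf M (al :: be :: ts) C) ^ 2 := by
  have c1 := Vf_cont (M := M) (al :: al :: ts) C
  have c2 := Vf_cont (M := M) (be :: be :: ts) C
  have c3 := Vf_cont (M := M) (al :: be :: ts) C
  have h0 : ∀ l : List (Finset E → ℝ), l.map (fun t => t + (0 : ℝ) • om) = l := by
    intro l; simp
  have key : ∀ᶠ ε : ℝ in nhdsWithin 0 (Set.Ioi 0),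
      Vf M ((al :: al :: ts).map (fun t => t + ε • om)) C *
      Vf M ((be :: be :: ts).map (fun t => t + ε • om)) C ≤
      (Vf M ((al :: be :: ts).map (fun t => t + ε • om)) C) ^ 2 := by
    filter_upwards [self_mem_nhdsWithin] with ε hε
    simp only [List.map_cons]
    refine HR _ ?_ C hC (by simpa using hl) _ (Cn_be hε) _
    intro t ht
    obtain ⟨s, hs, rfl⟩ := List.mem_map.1 ht
    rcases hts s hs with rfl | rfl
    · exact Cn_al hε
    · exact Cn_be hε
  have l1 := ((c1.mul c2).tendsto 0).mono_left (nhdsWithin_le_nhds (s := Set.Ioi 0))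
  have l2 := ((c3.pow 2).tendsto 0).mono_left (nhdsWithin_le_nhds (s := Set.Ioi 0))
  have h1 := le_of_tendsto_of_tendsto l1 l2 key
  simpa [-List.map_cons, h0] using h1

end Part5

section Part6

variable {E : Type*} [Fintype E] [DecidableEq E] {M : FlatSys E}

theorem Vf_zero {A B : Finset E} {k : ℕ} (hAk : M.rk A < k) (hkB : k < M.rk B)
    (l : List (Finset E → ℝ)) (h : ∀ t ∈ l, ∀ G, A ⊆ G → G ⊆ B → t G = 0) :
    ∀ C, IsCh M C → C.card + l.length = M.r + 1 → A ∈ C → B ∈ C → k ∈ miss M C →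
      Vf M l C = 0 := by
  induction l with
  | nil =>
    intro C hC hl hA hB hk
    have := hC.card_miss
    have h1 : (miss M C).card = 0 := by simp at hl; omega
    rw [Finset.card_eq_zero] at h1
    rw [h1] at hk
    simp at hk
  | cons t l ih =>
    intro C hC hl hA hB hk
    simp only [List.length_cons] at hl
    rw [Vf]
    refine Finset.sum_eq_zero (fun F hF => ?_)
    by_cases hFk : M.rk F = k
    · obtain ⟨A', B', hg, h1, h2⟩ := hC.gap hk
      have hAA : A ⊆ A' := by
        rcases hg.2.2.2 A hA with h3 | h3
        · exact h3
        · have := rk_mono (hC.1 _ hg.2.1) (hC.1 _ hA) h3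
          omega
      have hBB : B' ⊆ B := by
        rcases hg.2.2.2 B hB with h3 | h3
        · have := rk_mono (hC.1 _ hB) (hC.1 _ hg.1) h3
          omega
        · exact h3
      have hAF : A' ⊆ F := ((ext_ch hF).ssub (Finset.mem_insert_of_mem hg.1)
        (Finset.mem_insert_self _ _) (by omega)).subset
      have hFB : F ⊆ B' := ((ext_ch hF).ssub (Finset.mem_insert_self _ _)
        (Finset.mem_insert_of_mem hg.2.1) (by omega)).subset
      have ht := h t (by simp)
      rw [hg.N_eq hC t hAF hFB, ht F (hAA.trans hAF) (hFB.trans hBB),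
        ht A' hAA ((hAF.trans hFB).trans hBB), ht B' ((hAA.trans hAF).trans hFB) hBB]
      simp
    · rw [ih (fun t ht => h t (by simp [ht])) (insert F C) (ext_ch hF)
        (by rw [ext_card hF]; omega) (Finset.mem_insert_of_mem hA) (Finset.mem_insert_of_mem hB),
        mul_zero]
      rw [mem_miss] at hk ⊢
      refine ⟨hk.1, ?_⟩
      intro D hD
      rcases Finset.mem_insert.1 hD with rfl | hD
      · exact hFk
      · exact hk.2 D hD

lemma be_zero {b : ℕ} {A B : Finset E} (hA : A ≠ ∅) :
    ∀ t ∈ List.replicate b (be : Finset E → ℝ), ∀ G, A ⊆ G → G ⊆ B → t G = 0 := by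
  intro t ht G hG _
  rw [List.eq_of_mem_replicate ht, be, if_neg]
  rintro rfl
  exact hA (Finset.subset_empty.1 hG)

lemma be_step {C : Finset (Finset E)} (hC : IsCh M C) {F : Finset E} (hg : Gap C ∅ F) {i : E}
    (hi : i ∈ F) {ts : List (Finset E → ℝ)} (hl : C.card + ts.length = M.r) :
    Vf M (be :: ts) C = ∑ G ∈ (Ext M C).filter (fun G => G ⊂ F ∧ i ∉ G), Vf M ts (insert G C) := by
  rw [(bal ts).inv hC hl (t' := fun G => be G + 1 - if i ∈ G then 1 else 0)
    ⟨-1, Pi.single i 1, fun G => ?_⟩ ?_, Finset.sum_filter]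
  · refine Finset.sum_congr rfl (fun G hG => ?_)
    have hne : G ≠ ∅ := by rintro rfl; exact (mem_Ext.1 hG).1 hg.1
    simp only [be, if_neg hne]
    rcases hg.mid hG with h | h | h
    · exact absurd h (Finset.not_ssubset_empty _)
    · by_cases hiG : i ∈ G
      · simp [hiG]
      · simp [hiG, h.2]
    · have h2 := h.subset hi
      have h3 : ¬ G ⊂ F := fun h' => (h.trans h').ne rfl
      simp [h2]
  · intro D hD
    rcases hg.2.2.2 D hD with h | h
    · rw [Finset.subset_empty.1 h]; simp [be]
    · have h2 := h hi
      have : D ≠ ∅ := by rintro rfl; simp at h2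
      simp [be, h2, this]
  · rw [Finset.sum_pi_single']
    ring

lemma al_step {C : Finset (Finset E)} (hC : IsCh M C) {F : Finset E} (hg : Gap C F Finset.univ)
    {i : E} (hi : i ∉ F) {ts : List (Finset E → ℝ)} (hl : C.card + ts.length = M.r) :
    Vf M (al :: ts) C = ∑ G ∈ (Ext M C).filter (fun G => F ⊂ G ∧ i ∈ G), Vf M ts (insert G C) := by
  rw [(bal ts).inv hC hl (t' := fun G => al G + if i ∈ G then 1 else 0)
    ⟨0, Pi.single i (-1), fun G => ?_⟩ ?_, Finset.sum_filter]
  · refine Finset.sum_congr rfl (fun G hG => ?_)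
    have hne : G ≠ Finset.univ := by rintro rfl; exact (mem_Ext.1 hG).1 hg.2.1
    simp only [al, if_neg hne]
    rcases hg.mid hG with h | h | h
    · have hiG : i ∉ G := fun h' => hi (h.subset h')
      simp [hiG]
    · by_cases hiG : i ∈ G
      · simp [hiG, h.1]
      · simp [hiG]
    · exact absurd (Finset.subset_univ _) h.not_subset
  · intro D hD
    rcases hg.2.2.2 D hD with h | h
    · have h2 : i ∉ D := fun h' => hi (h h')
      have : D ≠ Finset.univ := by rintro rfl; simp at h2
      simp [al, h2, this]
    · rw [Finset.univ_subset_iff.1 h]; simp [al]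
  · rw [Finset.sum_pi_single']
    by_cases h : i ∈ G <;> simp [h]

/-- chains with bottom gap below `F` and saturated above -/
def Good (M : FlatSys E) (F : Finset E) (C : Finset (Finset E)) : Prop :=
  IsCh M C ∧ Gap C ∅ F ∧ C.card + M.rk F = M.r + 2

/-- unsigned Möbius function -/
noncomputable def mo (M : FlatSys E) (F : Finset E) : ℝ :=
  if h : ∃ C, Good M F C then Vf M (List.replicate (M.rk F - 1) be) h.choose else 1

lemma mo_empty : mo M ∅ = 1 := by
  rw [mo, dif_neg]
  rintro ⟨C, hC⟩
  exact hC.2.1.2.2.1.ne rfl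

lemma Gap.insert_below {C : Finset (Finset E)} {A B G : Finset E} (h : Gap C A B)
    (h1 : A ⊂ G) (h2 : G ⊂ B) : Gap (insert G C) A G := by
  refine ⟨Finset.mem_insert_of_mem h.1, Finset.mem_insert_self _ _, h1, ?_⟩
  intro D hD
  rcases Finset.mem_insert.1 hD with rfl | hD
  · exact Or.inr subset_rfl
  · rcases h.2.2.2 D hD with h3 | h3
    · exact Or.inl h3
    · exact Or.inr (h2.subset.trans h3)

lemma Gap.insert_above {C : Finset (Finset E)} {A B G : Finset E} (h : Gap C A B)
    (h1 : A ⊂ G) (h2 : G ⊂ B) : Gap (insert G C) G B := by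
  refine ⟨Finset.mem_insert_self _ _, Finset.mem_insert_of_mem h.2.1, h2, ?_⟩
  intro D hD
  rcases Finset.mem_insert.1 hD with rfl | hD
  · exact Or.inl subset_rfl
  · rcases h.2.2.2 D hD with h3 | h3
    · exact Or.inl (h3.trans h1.subset)
    · exact Or.inr h3

lemma empty_ssub {F : Finset E} (h : F ≠ ∅) : ∅ ⊂ F :=
  Finset.empty_ssubset.2 (Finset.nonempty_iff_ne_empty.2 h)

lemma rk_pos {F : Finset E} (hF : M.IsFlat F) (h : F ≠ ∅) : 0 < M.rk F := by
  have := M.rk_lt _ _ M.empty hF (empty_ssub h)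
  omega

lemma base_ch : IsCh M {∅, Finset.univ} := by
  refine ⟨?_, ?_, by simp, by simp⟩
  · intro A hA
    simp only [Finset.mem_insert, Finset.mem_singleton] at hA
    rcases hA with rfl | rfl
    · exact M.empty
    · exact M.univ
  · intro A hA B hB
    simp only [Finset.mem_insert, Finset.mem_singleton] at hA hB
    rcases hA with rfl | rfl
    · exact Or.inl (Finset.empty_subset _)
    · exact Or.inr (Finset.subset_univ _)

lemma base_gap (h : (Finset.univ : Finset E) ≠ ∅) :
    Gap {∅, (Finset.univ : Finset E)} ∅ Finset.univ := by
  refine ⟨by simp, by simp, empty_ssub h, ?_⟩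
  intro D hD
  simp only [Finset.mem_insert, Finset.mem_singleton] at hD
  rcases hD with rfl | rfl
  · exact Or.inl subset_rfl
  · exact Or.inr subset_rfl

lemma base_card (h : (Finset.univ : Finset E) ≠ ∅) :
    ({∅, (Finset.univ : Finset E)} : Finset (Finset E)).card = 2 :=
  Finset.card_pair (Ne.symm h)

lemma exists_good : ∀ (n : ℕ) (F : Finset E), M.IsFlat F → F ≠ ∅ → M.rk F + n = M.r →
    ∃ C, Good M F C := by
  intro n
  induction n with
  | zero =>
    intro F hF hne hr
    have : F = Finset.univ := eq_of_rk hF M.univ (Finset.subset_univ _)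
      (by simp only [FlatSys.r] at hr; omega)
    subst this
    refine ⟨_, base_ch, base_gap hne, ?_⟩
    rw [base_card hne]; omega
  | succ n ih =>
    intro F hF hne hr
    have : F ≠ Finset.univ := by
      rintro rfl
      simp only [FlatSys.r] at hr; omega
    obtain ⟨e, he⟩ : ∃ e, e ∉ F := by
      by_contra hcon
      push Not at hcon
      exact this (Finset.eq_univ_iff_forall.2 hcon)
    obtain ⟨G, h1, h2, h3, h4, h5⟩ := M.cover F e hF he
    have hFG : F ⊂ G := ssub_of_rk (M := M) h2 (by omega)
    obtain ⟨C, hC⟩ := ih G h1 (by rintro rfl; simp at h3) (by omega)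
    have hE := hC.2.1.mem_ext hC.1 hF (empty_ssub hne) hFG
    refine ⟨insert F C, ext_ch hE, hC.2.1.insert_below (empty_ssub hne) hFG, ?_⟩
    have := hC.2.2
    rw [ext_card hE]; omega

lemma good_rec : ∀ (n : ℕ) (F : Finset E), M.IsFlat F → M.rk F = n + 1 → ∀ C, Good M F C →
    Vf M (List.replicate n be) C = mo M F ∧ ∀ i ∈ F, mo M F =
      ∑ G ∈ Finset.univ.filter (fun G => M.IsFlat G ∧ G ⊂ F ∧ M.rk G + 1 = M.rk F ∧ i ∉ G),
        mo M G := by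
  intro n
  induction n with
  | zero =>
    intro F hF hr C hC
    have hne : F ≠ ∅ := by rintro rfl; rw [M.rk_empty] at hr; omega
    have h1 : mo M F = 1 := by
      rw [mo, dif_pos ⟨C, hC⟩, hr]; rfl
    refine ⟨by rw [h1]; rfl, ?_⟩
    intro i hi
    rw [h1, Finset.sum_eq_single ∅, mo_empty]
    · intro G hG hGne
      simp only [Finset.mem_filter] at hG
      have := rk_pos hG.2.1 hGne
      omega
    · intro h
      exfalso
      apply h
      simp [M.empty, empty_ssub hne, hr, M.rk_empty]
  | succ n ih =>
    intro F hF hr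
    have hne : F ≠ ∅ := by rintro rfl; rw [M.rk_empty] at hr; omega
    have key : ∀ C, Good M F C → ∀ i ∈ F, Vf M (List.replicate (n + 1) be) C =
        ∑ G ∈ Finset.univ.filter (fun G => M.IsFlat G ∧ G ⊂ F ∧ M.rk G + 1 = M.rk F ∧ i ∉ G),
        mo M G := by
      intro C hC i hi
      have hcard := hC.2.2
      rw [List.replicate_succ, be_step hC.1 hC.2.1 hi (by simp; omega)]
      symm
      refine Finset.sum_subset_zero_on_sdiff ?_ ?_ ?_
      · intro G hG
        simp only [Finset.mem_filter, Finset.mem_univ, true_and] at hG ⊢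
        refine ⟨hC.2.1.mem_ext hC.1 hG.1 (empty_ssub ?_) hG.2.1, hG.2.1, hG.2.2.2⟩
        rintro rfl
        have := hG.2.2.1
        rw [M.rk_empty] at this
        omega
      · intro G hG
        simp only [Finset.mem_filter, Finset.mem_univ, true_and, Finset.mem_sdiff] at hG
        obtain ⟨⟨hG1, hG2, hG3⟩, hG4⟩ := hG
        have hGf := ext_flat hG1
        have hGne : G ≠ ∅ := by rintro rfl; exact (mem_Ext.1 hG1).1 hC.2.1.1
        have hrk := M.rk_lt _ _ hGf hF hG2
        have hrk' : M.rk G + 1 ≠ M.rk F := fun h => hG4 ⟨hGf, hG2, h, hG3⟩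
        refine Vf_zero (k := M.rk G + 1) (A := G) (B := F) (by omega) (by omega) _
          (be_zero hGne) _ (ext_ch hG1) (by rw [ext_card hG1]; simp; omega)
          (Finset.mem_insert_self _ _) (Finset.mem_insert_of_mem hC.2.1.2.1) ?_
        exact (hC.2.1.insert_above (empty_ssub hGne) hG2).miss (ext_ch hG1) (by omega) (by omega)
      · intro G hG
        simp only [Finset.mem_filter, Finset.mem_univ, true_and] at hG
        have hGne : G ≠ ∅ := by
          rintro rfl
          have := hG.2.2.1
          rw [M.rk_empty] at this
          omega
        have hE := hC.2.1.mem_ext hC.1 hG.1 (empty_ssub hGne) hG.2.1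
        refine ((ih G hG.1 (by omega) (insert G C) ⟨ext_ch hE,
          hC.2.1.insert_below (empty_ssub hGne) hG.2.1, ?_⟩).1).symm
        rw [ext_card hE]; omega
    obtain ⟨i0, hi0⟩ := Finset.nonempty_iff_ne_empty.2 hne
    intro C hC
    have hm : Vf M (List.replicate (n + 1) be) C = mo M F := by
      have hex : ∃ C, Good M F C := ⟨C, hC⟩
      rw [key C hC i0 hi0, mo, dif_pos hex, hr, Nat.add_sub_cancel, key _ hex.choose_spec i0 hi0, hr]
    exact ⟨hm, fun i hi => by rw [← hm, key C hC i hi]⟩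

lemma mo_rec {F : Finset E} (hF : M.IsFlat F) {i : E} (hi : i ∈ F) : mo M F =
      ∑ G ∈ Finset.univ.filter (fun G => M.IsFlat G ∧ G ⊂ F ∧ M.rk G + 1 = M.rk F ∧ i ∉ G),
        mo M G := by
  have hne : F ≠ ∅ := by rintro rfl; simp at hi
  have h0 := rk_pos hF hne
  have h1 := rk_le_r hF
  obtain ⟨C, hC⟩ := exists_good (M.r - M.rk F) F hF hne (by omega)
  exact (good_rec (M.rk F - 1) F hF (by omega) C hC).2 i hi

lemma mo_good {F : Finset E} {n : ℕ} (hF : M.IsFlat F) (hr : M.rk F = n + 1)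
    {C : Finset (Finset E)} (hC : Good M F C) : Vf M (List.replicate n be) C = mo M F :=
  (good_rec n F hF hr C hC).1

lemma mo_pos : ∀ (n : ℕ) (F : Finset E), M.IsFlat F → M.rk F = n → 0 < mo M F := by
  intro n
  induction n with
  | zero =>
    intro F hF hr
    have : F = ∅ := by
      by_contra hne
      have := rk_pos hF hne
      omega
    rw [this, mo_empty]; norm_num
  | succ n ih =>
    intro F hF hr
    have hne : F ≠ ∅ := by rintro rfl; rw [M.rk_empty] at hr; omega
    obtain ⟨i, hi⟩ := Finset.nonempty_iff_ne_empty.2 hne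
    rw [mo_rec hF hi]
    refine Finset.sum_pos ?_ ?_
    · intro G hG
      simp only [Finset.mem_filter, Finset.mem_univ, true_and] at hG
      exact ih G hG.1 (by omega)
    · obtain ⟨G, hG, hmax⟩ := Finset.exists_max_image
        (Finset.univ.filter (fun G => M.IsFlat G ∧ G ⊂ F ∧ i ∉ G)) M.rk
        ⟨∅, by simp [M.empty, empty_ssub hne]⟩
      simp only [Finset.mem_filter, Finset.mem_univ, true_and] at hG hmax
      refine ⟨G, ?_⟩
      simp only [Finset.mem_filter, Finset.mem_univ, true_and]
      refine ⟨hG.1, hG.2.1, ?_, hG.2.2⟩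
      obtain ⟨H, h1, h2, h3, h4, h5⟩ := M.cover G i hG.1 hG.2.2
      have hHF := h5 F hF hG.2.1.subset hi
      have hFH : F ⊆ H := by
        intro e he
        by_contra heH
        have heG : e ∉ G := fun h => heH (h2 h)
        obtain ⟨K, k1, k2, k3, k4, k5⟩ := M.cover G e hG.1 heG
        have hKF := k5 F hF hG.2.1.subset he
        by_cases hiK : i ∈ K
        · have := eq_of_rk h1 k1 (h5 K k1 k2 hiK) (by omega)
          exact heH (this ▸ k3)
        · have := hmax K ⟨k1, hKF.ssubset_of_ne (by rintro rfl; exact hiK hi), hiK⟩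
          omega
      rw [← h4, hHF.antisymm hFH]

/-- double counting through the unique cover containing `i` -/
lemma cover_sum (i : E) (f : Finset E → ℝ) (Q Q' : Finset E → Prop)
    (hQ : ∀ G H, M.IsFlat G → M.IsFlat H → G ⊂ H → M.rk G + 1 = M.rk H → i ∈ H → i ∉ G →
      (∀ B, M.IsFlat B → G ⊆ B → i ∈ B → H ⊆ B) → (Q H ↔ Q' G)) :
    ∑ H ∈ Finset.univ.filter (fun H => M.IsFlat H ∧ i ∈ H ∧ Q H),
      ∑ G ∈ Finset.univ.filter (fun G => M.IsFlat G ∧ G ⊂ H ∧ M.rk G + 1 = M.rk H ∧ i ∉ G), f G =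
    ∑ G ∈ Finset.univ.filter (fun G => M.IsFlat G ∧ i ∉ G ∧ Q' G), f G := by
  choose! cl c1 c2 c3 c4 c5 using fun (G : Finset E) (h : M.IsFlat G ∧ i ∉ G) =>
    M.cover G i h.1 h.2
  have hc : ∀ G H, M.IsFlat G → i ∉ G → M.IsFlat H → i ∈ H → G ⊂ H → M.rk G + 1 = M.rk H →
      H = cl G := by
    intro G H h1 h2 h3 h4 h5 h6
    exact (eq_of_rk (c1 G ⟨h1, h2⟩) h3 (c5 G ⟨h1, h2⟩ H h3 h5.subset h4)
      (by rw [c4 G ⟨h1, h2⟩]; omega)).symm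
  have hcl : ∀ G, M.IsFlat G → i ∉ G → G ⊂ cl G := fun G h1 h2 =>
    (c2 G ⟨h1, h2⟩).ssubset_of_ne (by intro h; exact h2 (h ▸ c3 G ⟨h1, h2⟩))
  have hiff : ∀ G, M.IsFlat G → i ∉ G → (Q (cl G) ↔ Q' G) := fun G h1 h2 =>
    hQ G (cl G) h1 (c1 G ⟨h1, h2⟩) (hcl G h1 h2) (c4 G ⟨h1, h2⟩).symm (c3 G ⟨h1, h2⟩) h2
      (c5 G ⟨h1, h2⟩)
  rw [Finset.sum_comm' (t' := Finset.univ.filter (fun G => M.IsFlat G ∧ i ∉ G ∧ Q' G))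
    (s' := fun G => {cl G})]
  · simp
  · intro H G
    simp only [Finset.mem_filter, Finset.mem_univ, true_and, Finset.mem_singleton]
    constructor
    · rintro ⟨⟨h1, h2, h3⟩, h4, h5, h6, h7⟩
      have := hc G H h4 h7 h1 h2 h5 h6
      refine ⟨this, h4, h7, (hiff G h4 h7).1 (this ▸ h3)⟩
    · rintro ⟨rfl, h4, h7, h8⟩
      exact ⟨⟨c1 G ⟨h4, h7⟩, c3 G ⟨h4, h7⟩, (hiff G h4 h7).2 h8⟩, h4, hcl G h4 h7,
        (c4 G ⟨h4, h7⟩).symm, h7⟩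

theorem mo_alt {F : Finset E} (hF : M.IsFlat F) (hne : F ≠ ∅) :
    ∑ G ∈ Finset.univ.filter (fun G => M.IsFlat G ∧ G ⊆ F), (-1 : ℝ) ^ M.rk G * mo M G = 0 := by
  obtain ⟨i, hi⟩ := Finset.nonempty_iff_ne_empty.2 hne
  have h := cover_sum (M := M) i (fun G => (-1 : ℝ) ^ M.rk G * mo M G) (fun H => H ⊆ F)
    (fun G => G ⊆ F) (by
      intro G H _ _ h1 _ h2 h3 h4
      exact ⟨fun h => h1.subset.trans h, fun h => h4 F hF h hi⟩)
  rw [← Finset.sum_filter_add_sum_filter_not _ (fun G => i ∉ G), Finset.filter_filter,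
    Finset.filter_filter]
  have e1 : ∑ G ∈ Finset.univ.filter (fun G => (M.IsFlat G ∧ G ⊆ F) ∧ i ∉ G),
      (-1 : ℝ) ^ M.rk G * mo M G = ∑ G ∈ Finset.univ.filter (fun G => M.IsFlat G ∧ i ∉ G ∧ G ⊆ F),
      (-1 : ℝ) ^ M.rk G * mo M G := by
    congr 1; ext G; simp; tauto
  have e2 : ∑ H ∈ Finset.univ.filter (fun G => (M.IsFlat G ∧ G ⊆ F) ∧ ¬ i ∉ G),
      (-1 : ℝ) ^ M.rk H * mo M H = - ∑ H ∈ Finset.univ.filter (fun G => M.IsFlat G ∧ i ∈ G ∧ G ⊆ F),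
      ∑ G ∈ Finset.univ.filter (fun G => M.IsFlat G ∧ G ⊂ H ∧ M.rk G + 1 = M.rk H ∧ i ∉ G),
        (-1 : ℝ) ^ M.rk G * mo M G := by
    rw [← Finset.sum_neg_distrib]
    refine Finset.sum_congr (by ext G; simp; tauto) ?_
    intro H hH
    simp only [Finset.mem_filter, Finset.mem_univ, true_and] at hH
    rw [mo_rec hH.1 hH.2.1, Finset.mul_sum, ← Finset.sum_neg_distrib]
    refine Finset.sum_congr rfl (fun G hG => ?_)
    simp only [Finset.mem_filter, Finset.mem_univ, true_and] at hG
    rw [← hG.2.2.1, pow_succ]; ring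
  rw [e1, e2, add_neg_eq_zero]
  symm
  convert h

/-- coefficients of the reduced characteristic polynomial -/
noncomputable def ared (M : FlatSys E) (i : E) (k : ℕ) : ℝ :=
  ∑ F ∈ Finset.univ.filter (fun F => M.IsFlat F ∧ i ∈ F ∧ M.rk F = k + 1), mo M F

/-- unsigned Whitney numbers -/
noncomputable def whit (M : FlatSys E) (k : ℕ) : ℝ :=
  ∑ F ∈ Finset.univ.filter (fun F => M.IsFlat F ∧ M.rk F = k), mo M F

lemma ared_eq (i : E) (k : ℕ) : ared M i k =
    ∑ F ∈ Finset.univ.filter (fun F => M.IsFlat F ∧ i ∉ F ∧ M.rk F = k), mo M F := by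
  have h := cover_sum (M := M) i (mo M) (fun H => M.rk H = k + 1) (fun G => M.rk G = k)
    (by intros; omega)
  have e : ared M i k = ∑ H ∈ Finset.univ.filter (fun H => M.IsFlat H ∧ i ∈ H ∧ M.rk H = k + 1),
      ∑ G ∈ Finset.univ.filter (fun G => M.IsFlat G ∧ G ⊂ H ∧ M.rk G + 1 = M.rk H ∧ i ∉ G),
        mo M G := by
    refine Finset.sum_congr rfl (fun H hH => ?_)
    simp only [Finset.mem_filter, Finset.mem_univ, true_and] at hH
    exact mo_rec hH.1 hH.2.1
  rw [e]
  convert h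

lemma whit_succ (i : E) (k : ℕ) : whit M (k + 1) = ared M i k + ared M i (k + 1) := by
  rw [ared_eq i (k + 1), ared, whit, ← Finset.sum_filter_add_sum_filter_not _ (fun G => i ∈ G),
    Finset.filter_filter, Finset.filter_filter]
  congr 1 <;> (congr 1; ext G; simp; tauto)

lemma whit_zero (i : E) : whit M 0 = ared M i 0 := by
  rw [ared_eq, whit]
  congr 1
  ext G
  simp only [Finset.mem_filter, Finset.mem_univ, true_and]
  constructor
  · rintro ⟨h1, h2⟩
    refine ⟨h1, ?_, h2⟩
    intro hi
    have := rk_pos h1 (by rintro rfl; simp at hi)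
    omega
  · tauto

lemma ared_nonneg (i : E) (k : ℕ) : 0 ≤ ared M i k := by
  refine Finset.sum_nonneg (fun F hF => ?_)
  simp only [Finset.mem_filter, Finset.mem_univ, true_and] at hF
  exact (mo_pos _ F hF.1 rfl).le

lemma ared_zero (i : E) {k : ℕ} (hk : M.r ≤ k) : ared M i k = 0 := by
  refine Finset.sum_eq_zero (fun F hF => ?_)
  simp only [Finset.mem_filter, Finset.mem_univ, true_and] at hF
  have := rk_le_r hF.1
  omega

lemma exists_flat_rk (i : E) : ∀ k, k + 1 ≤ M.r → ∃ F, M.IsFlat F ∧ i ∈ F ∧ M.rk F = k + 1 := by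
  intro k
  induction k with
  | zero =>
    intro _
    obtain ⟨G, h1, h2, h3, h4, h5⟩ := M.cover ∅ i M.empty (by simp)
    exact ⟨G, h1, h3, by rw [h4, M.rk_empty]⟩
  | succ k ih =>
    intro hk
    obtain ⟨F, h1, h2, h3⟩ := ih (by omega)
    have : F ≠ Finset.univ := by
      rintro rfl
      simp only [FlatSys.r] at hk; omega
    obtain ⟨e, he⟩ : ∃ e, e ∉ F := by
      by_contra hcon
      push Not at hcon
      exact this (Finset.eq_univ_iff_forall.2 hcon)
    obtain ⟨G, g1, g2, g3, g4, g5⟩ := M.cover F e h1 he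
    exact ⟨G, g1, g2 h2, by omega⟩

lemma ared_pos (i : E) {k : ℕ} (hk : k + 1 ≤ M.r) : 0 < ared M i k := by
  refine Finset.sum_pos (fun F hF => ?_) ?_
  · simp only [Finset.mem_filter, Finset.mem_univ, true_and] at hF
    exact mo_pos _ F hF.1 rfl
  · obtain ⟨F, hF⟩ := exists_flat_rk (M := M) i k hk
    exact ⟨F, by simpa using hF⟩

lemma al_be_zero {a b : ℕ} : ∀ (C : Finset (Finset E)), IsCh M C → C.card + a + b = M.r + 1 →
    ∀ F, Gap C ∅ F → F ≠ Finset.univ → M.rk F ≠ b + 1 →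
    Vf M (List.replicate a al ++ List.replicate b be) C = 0 := by
  induction a with
  | zero =>
    intro C hC hl F hg hF hr
    have hFf := hC.1 F hg.2.1
    have hne : F ≠ ∅ := by rintro rfl; exact hg.2.2.1.ne rfl
    have hm : ∃ k ∈ miss M C, M.rk F < k := by
      by_contra hcon
      push Not at hcon
      have hsub : miss M C = Finset.Ioo 0 (M.rk F) := by
        ext k
        rw [Finset.mem_Ioo]
        constructor
        · intro hk
          have h1 := hcon k hk
          rw [mem_miss] at hk
          have h2 := hk.2 ∅ hC.2.2.1
          have h3 := hk.2 F hg.2.1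
          rw [M.rk_empty] at h2
          omega
        · rintro ⟨h1, h2⟩
          exact hg.miss hC (by rw [M.rk_empty]; exact h1) h2
      have h1 := hC.card_miss
      rw [hsub, Nat.card_Ioo] at h1
      have := rk_pos hFf hne
      omega
    obtain ⟨k, hk, hkF⟩ := hm
    have hkr : k < M.rk Finset.univ := by
      have h1 := (mem_miss.1 hk).1
      have h2 := (mem_miss.1 hk).2 _ hC.2.2.2
      simp only [FlatSys.r] at h1
      omega
    simp only [List.replicate_zero, List.nil_append]
    exact Vf_zero hkF hkr _ (be_zero hne) C hC (by simp; omega) hg.2.1 hC.2.2.2 hk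
  | succ a ih =>
    intro C hC hl F hg hF hr
    rw [List.replicate_succ, List.cons_append, Vf]
    refine Finset.sum_eq_zero (fun H hH => ?_)
    rcases hg.mid hH with h | h | h
    · exact absurd h (Finset.not_ssubset_empty _)
    · have hHu : H ≠ Finset.univ := by
        rintro rfl; exact h.2.not_subset (Finset.subset_univ _)
      have heu : (∅ : Finset E) ≠ Finset.univ := by
        intro h'; exact (h' ▸ h.1).not_subset (Finset.subset_univ _)
      rw [hg.N_eq hC al h.1.subset h.2.subset]
      simp [al, hHu, heu, hF]
    · rw [ih (insert H C) (ext_ch hH) (by rw [ext_card hH]; omega) F ?_ hF hr, mul_zero]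
      refine ⟨Finset.mem_insert_of_mem hg.1, Finset.mem_insert_of_mem hg.2.1, hg.2.2.1, ?_⟩
      intro D hD
      rcases Finset.mem_insert.1 hD with rfl | hD
      · exact Or.inr h.subset
      · exact hg.2.2.2 D hD

lemma al_be_good {a b : ℕ} : ∀ (C : Finset (Finset E)), IsCh M C → C.card + a + b = M.r + 1 →
    ∀ F A, Gap C ∅ F → M.rk F = b + 1 → F ⊆ A → Gap C A Finset.univ → M.rk A + a + 1 = M.r →
    Vf M (List.replicate a al ++ List.replicate b be) C = mo M F := by
  induction a with
  | zero =>
    intro C hC hl F A hg hr _ _ _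
    simp only [List.replicate_zero, List.nil_append]
    exact mo_good (hC.1 F hg.2.1) hr ⟨hC, hg, by omega⟩
  | succ a ih =>
    intro C hC hl F A hg hr hFA hgA hA
    have hne : F ≠ ∅ := by rintro rfl; exact hg.2.2.1.ne rfl
    have hAne : A ≠ ∅ := by rintro rfl; exact hne (Finset.subset_empty.1 hFA)
    obtain ⟨i, _, hi⟩ := hgA.exists_mem
    rw [List.replicate_succ, List.cons_append, al_step hC hgA hi (by simp; omega)]
    obtain ⟨H, h1, h2, h3, h4, h5, h6⟩ := hgA.cover hC (by simp only [FlatSys.r] at hA; omega)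
      (Finset.mem_univ i) hi
    rw [Finset.sum_eq_single H]
    · refine ih (insert H C) (ext_ch h1) (by rw [ext_card h1]; omega) F H ?_ hr
        (hFA.trans h2.subset) (hgA.insert_above h2 h3) (by omega)
      refine ⟨Finset.mem_insert_of_mem hg.1, Finset.mem_insert_of_mem hg.2.1, hg.2.2.1, ?_⟩
      intro D hD
      rcases Finset.mem_insert.1 hD with rfl | hD
      · exact Or.inr (hFA.trans h2.subset)
      · exact hg.2.2.2 D hD
    · intro G hG hne'
      simp only [Finset.mem_filter] at hG
      have hGf := ext_flat hG.1
      have hHG := h6 G hGf hG.2.1.subset hG.2.2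
      have hrk := M.rk_lt _ _ (ext_flat h1) hGf (hHG.ssubset_of_ne (Ne.symm hne'))
      have hGu : G ≠ Finset.univ := by rintro rfl; exact (mem_Ext.1 hG.1).1 hC.2.2.2
      refine Vf_zero (A := A) (B := G) (k := M.rk A + 1) (by omega) (by omega) _ ?_ _ (ext_ch hG.1)
        (by rw [ext_card hG.1]; simp; omega) (Finset.mem_insert_of_mem hgA.1)
        (Finset.mem_insert_self _ _)
        ((hgA.insert_below hG.2.1 (Finset.ssubset_univ_iff.2 hGu)).miss (ext_ch hG.1) (by omega)
          (by omega))
      intro t ht K hAK hKG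
      rcases List.mem_append.1 ht with ht | ht
      · rw [List.eq_of_mem_replicate ht, al, if_neg]
        rintro rfl
        exact hGu (Finset.univ_subset_iff.1 hKG)
      · exact be_zero hAne t ht K hAK hKG
    · intro h
      exact absurd (Finset.mem_filter.2 ⟨h1, h2, h4⟩) h

theorem Vf_ared (i : E) {a b : ℕ} (hr : a + b + 1 = M.r) :
    Vf M (List.replicate a al ++ List.replicate b be) {∅, Finset.univ} = ared M i b := by
  have hu : (Finset.univ : Finset E) ≠ ∅ := Finset.nonempty_iff_ne_empty.1 ⟨i, Finset.mem_univ i⟩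
  rw [ared]
  cases a with
  | zero =>
    simp only [List.replicate_zero, List.nil_append]
    have hr' : M.rk Finset.univ = b + 1 := by simp only [FlatSys.r] at hr; omega
    rw [mo_good (F := Finset.univ) M.univ hr' ⟨base_ch, base_gap hu, by
      rw [base_card hu, hr']; omega⟩, Finset.sum_eq_single Finset.univ]
    · intro F hF hne
      simp only [Finset.mem_filter, Finset.mem_univ, true_and] at hF
      exact absurd (eq_of_rk hF.1 M.univ (Finset.subset_univ _) (by omega)) hne
    · intro h
      exfalso; apply h
      simp [M.univ, hr']
  | succ a =>
    rw [List.replicate_succ, List.cons_append,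
      al_step base_ch (base_gap hu) (Finset.notMem_empty i) (by rw [base_card hu]; simp; omega)]
    symm
    have hmem : ∀ F, M.IsFlat F → M.rk F = b + 1 → F ∈ Ext M {∅, Finset.univ} := by
      intro F hF hrF
      refine (base_gap hu).mem_ext base_ch hF (empty_ssub ?_) (Finset.ssubset_univ_iff.2 ?_)
      · rintro rfl; rw [M.rk_empty] at hrF; omega
      · rintro rfl; simp only [FlatSys.r] at hr; omega
    refine Finset.sum_subset_zero_on_sdiff ?_ ?_ ?_
    · intro F hF
      simp only [Finset.mem_filter, Finset.mem_univ, true_and] at hF ⊢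
      exact ⟨hmem F hF.1 hF.2.2, empty_ssub (by rintro rfl; simp at hF), hF.2.1⟩
    · intro G hG
      simp only [Finset.mem_filter, Finset.mem_univ, true_and, Finset.mem_sdiff] at hG
      have hGu : G ≠ Finset.univ := by rintro rfl; exact (mem_Ext.1 hG.1.1).1 (by simp)
      refine al_be_zero _ (ext_ch hG.1.1) (by rw [ext_card hG.1.1, base_card hu]; omega) G
        ((base_gap hu).insert_below hG.1.2.1 (Finset.ssubset_univ_iff.2 hGu)) hGu ?_
      intro h
      exact hG.2 ⟨ext_flat hG.1.1, hG.1.2.2, h⟩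
    · intro F hF
      simp only [Finset.mem_filter, Finset.mem_univ, true_and] at hF
      have hE := hmem F hF.1 hF.2.2
      have hFu : F ≠ Finset.univ := by rintro rfl; exact (mem_Ext.1 hE).1 (by simp)
      have hF0 : F ≠ ∅ := by rintro rfl; exact (mem_Ext.1 hE).1 (by simp)
      have hsu := Finset.ssubset_univ_iff.2 hFu
      exact (al_be_good _ (ext_ch hE) (by rw [ext_card hE, base_card hu]; omega) F F
        ((base_gap hu).insert_below (empty_ssub hF0) hsu) hF.2.2 subset_rfl
        ((base_gap hu).insert_above (empty_ssub hF0) hsu) (by omega)).symm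

theorem ared_lc (i : E) (b : ℕ) : ared M i b * ared M i (b + 2) ≤ ared M i (b + 1) ^ 2 := by
  by_cases hb : b + 3 ≤ M.r
  · have hu : (Finset.univ : Finset E) ≠ ∅ :=
      Finset.nonempty_iff_ne_empty.1 ⟨i, Finset.mem_univ i⟩
    obtain ⟨a, ha⟩ := Nat.exists_eq_add_of_le hb
    have h := HR_lim (M := M) base_ch (List.replicate a al ++ List.replicate b be) ?_ ?_
    · rw [← Vf_ared i (a := a + 2) (b := b) (by omega), ← Vf_ared i (a := a) (b := b + 2) (by omega),
        ← Vf_ared i (a := a + 1) (b := b + 1) (by omega)]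
      have hc := base_card hu
      have e1 : Vf M (be :: be :: (List.replicate a al ++ List.replicate b be)) {∅, Finset.univ} =
          Vf M (List.replicate a al ++ List.replicate (b + 2) be) {∅, Finset.univ} := by
        refine Vf_perm ?_ base_ch (by simp [hc]; omega)
        rw [List.replicate_succ, List.replicate_succ]
        exact ((List.perm_middle.symm).cons _).trans List.perm_middle.symm
      have e2 : Vf M (al :: be :: (List.replicate a al ++ List.replicate b be)) {∅, Finset.univ} =
          Vf M (List.replicate (a + 1) al ++ List.replicate (b + 1) be) {∅, Finset.univ} := by
        refine Vf_perm ?_ base_ch (by simp [hc]; omega)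
        rw [List.replicate_succ, List.replicate_succ, List.cons_append]
        exact (List.perm_middle.symm).cons _
      rw [← e1, ← e2]
      exact h
    · intro t ht
      rcases List.mem_append.1 ht with ht | ht
      · exact Or.inl (List.eq_of_mem_replicate ht)
      · exact Or.inr (List.eq_of_mem_replicate ht)
    · rw [base_card hu]; simp; omega
  · rw [ared_zero i (k := b + 2) (by omega), mul_zero]
    positivity

theorem whit_lc (i : E) (k : ℕ) : whit M k * whit M (k + 2) ≤ whit M (k + 1) ^ 2 := by
  have hy := ared_nonneg (M := M) i k
  have hz := ared_nonneg (M := M) i (k + 1)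
  have ht := ared_nonneg (M := M) i (k + 2)
  have h2 := ared_lc (M := M) i k
  rw [whit_succ i (k + 1), whit_succ i k]
  cases k with
  | zero =>
    rw [whit_zero i]
    simp only [zero_add] at *
    nlinarith [mul_nonneg hy hz]
  | succ k =>
    rw [whit_succ i k]
    have hx := ared_nonneg (M := M) i k
    have h1 := ared_lc (M := M) i k
    have h3 : ared M i k * ared M i (k + 1 + 2) ≤ ared M i (k + 1) * ared M i (k + 1 + 1) := by
      by_cases hk : k + 4 ≤ M.r
      · have p1 := ared_pos (M := M) i (k := k + 1) (by omega)
        have p2 := ared_pos (M := M) i (k := k + 1 + 1) (by omega)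
        have p3 := mul_pos p1 p2
        refine le_of_mul_le_mul_right ?_ p3
        have := mul_le_mul h1 h2 (mul_nonneg hy ht) (sq_nonneg _)
        calc _ = ared M i k * ared M i (k + 2) * (ared M i (k + 1) * ared M i (k + 1 + 2)) := by
              ring
          _ ≤ _ := this
          _ = _ := by ring
      · rw [ared_zero i (k := k + 1 + 2) (by omega), mul_zero]
        exact mul_nonneg hy hz
    have h1' : ared M i k * ared M i (k + 1 + 1) ≤ ared M i (k + 1) ^ 2 := h1
    nlinarith [mul_nonneg hy hz]

end Part6

section Part7

variable {E : Type*} [Fintype E] [DecidableEq E] {M : FlatSys E}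

lemma whit_nonneg (k : ℕ) : 0 ≤ whit M k := by
  refine Finset.sum_nonneg (fun F hF => ?_)
  simp only [Finset.mem_filter, Finset.mem_univ, true_and] at hF
  exact (mo_pos _ F hF.1 rfl).le

theorem whit_lc' (k : ℕ) : whit M k * whit M (k + 2) ≤ whit M (k + 1) ^ 2 := by
  rcases isEmpty_or_nonempty E with h | ⟨⟨i⟩⟩
  · have : whit M (k + 2) = 0 := by
      refine Finset.sum_eq_zero (fun F hF => ?_)
      simp only [Finset.mem_filter, Finset.mem_univ, true_and] at hF
      have h1 : F = ∅ := Finset.eq_empty_of_isEmpty F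
      have h2 := hF.2
      rw [h1, M.rk_empty] at h2
      omega
    rw [this, mul_zero]
    positivity
  · exact whit_lc i k

section Graph

variable {V : Type*} [Fintype V] (Γ : SimpleGraph V)

/-- oriented edges -/
abbrev Dt := {d : V × V // Γ.Adj d.1 d.2}

/-- the functional of an oriented edge -/
def phi (e : Dt Γ) : (V → ℚ) →ₗ[ℚ] ℚ :=
  (LinearMap.proj (R := ℚ) (φ := fun _ : V => ℚ) e.1.1) -
    (LinearMap.proj (R := ℚ) (φ := fun _ : V => ℚ) e.1.2)

lemma phi_eq (e : Dt Γ) (c : V → ℚ) : phi Γ e c = 0 ↔ c e.1.1 = c e.1.2 := by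
  simp [phi, sub_eq_zero]

/-- functions constant along the edges of `F` -/
def W (F : Finset (Dt Γ)) : Submodule ℚ (V → ℚ) where
  carrier := {c | ∀ e ∈ F, phi Γ e c = 0}
  add_mem' := by
    intro a b ha hb e he
    rw [map_add, ha e he, hb e he, add_zero]
  zero_mem' := by
    intro e _
    simp
  smul_mem' := by
    intro r a ha e he
    rw [map_smul, ha e he, smul_zero]

lemma mem_W {F : Finset (Dt Γ)} {c : V → ℚ} : c ∈ W Γ F ↔ ∀ e ∈ F, phi Γ e c = 0 := Iff.rfl

/-- flats of the graphic matroid -/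
def gFlat (F : Finset (Dt Γ)) : Prop := ∀ e, (∀ c ∈ W Γ F, phi Γ e c = 0) → e ∈ F

lemma finrank_W_le (F : Finset (Dt Γ)) : Module.finrank ℚ (W Γ F) ≤ Fintype.card V := by
  have := Submodule.finrank_le (W Γ F)
  rwa [Module.finrank_fintype_fun_eq_card] at this

lemma W_anti {A B : Finset (Dt Γ)} (h : A ⊆ B) : W Γ B ≤ W Γ A := fun _ hc e he => hc e (h he)

lemma finrank_inf_ker {U : Submodule ℚ (V → ℚ)} {f : (V → ℚ) →ₗ[ℚ] ℚ} (h : ∃ c ∈ U, f c ≠ 0) :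
    Module.finrank ℚ (U ⊓ LinearMap.ker f : Submodule ℚ (V → ℚ)) + 1 = Module.finrank ℚ U := by
  obtain ⟨c, hc, hfc⟩ := h
  have h1 : f.domRestrict U ≠ 0 := by
    intro h
    apply hfc
    have := congrArg (fun g => g ⟨c, hc⟩) h
    simpa using this
  have h2 := Module.Dual.finrank_ker_add_one_of_ne_zero (f := f.domRestrict U) h1
  have h3 : (LinearMap.ker (f.domRestrict U)).map U.subtype = U ⊓ LinearMap.ker f := by
    ext x
    simp only [Submodule.mem_map, LinearMap.mem_ker, Submodule.mem_inf]
    constructor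
    · rintro ⟨y, hy, rfl⟩
      exact ⟨y.2, by simpa using hy⟩
    · rintro ⟨hx, hx'⟩
      exact ⟨⟨x, hx⟩, by simpa using hx', rfl⟩
  rw [← h3, ← h2]
  congr 1
  exact Submodule.finrank_map_subtype_eq U _

/-- the graphic matroid -/
noncomputable def gM : FlatSys (Dt Γ) where
  IsFlat := gFlat Γ
  rk F := Fintype.card V - Module.finrank ℚ (W Γ F)
  empty := by
    intro e he
    exfalso
    have h := he (Pi.single e.1.1 1) (by intro e he; simp at he)
    rw [phi_eq, Pi.single_eq_same, Pi.single_eq_of_ne (Ne.symm e.2.ne)] at h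
    norm_num at h
  univ := fun e _ => Finset.mem_univ e
  rk_empty := by
    have : W Γ ∅ = ⊤ := by
      rw [eq_top_iff]
      intro c _ e he
      simp at he
    rw [this, finrank_top, Module.finrank_fintype_fun_eq_card, Nat.sub_self]
  rk_lt := by
    intro A B hA hB hAB
    have h1 : W Γ B < W Γ A := by
      refine lt_of_le_of_ne (W_anti Γ hAB.subset) ?_
      intro h
      obtain ⟨e, heB, heA⟩ := Finset.exists_of_ssubset hAB
      apply heA
      apply hA
      intro c hc
      rw [← h] at hc
      exact hc e heB
    have h2 := Submodule.finrank_lt_finrank_of_lt h1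
    have h3 := finrank_W_le Γ A
    omega
  cover := by
    intro A e hA he
    set G : Finset (Dt Γ) := Finset.univ.filter
      (fun e' => ∀ c ∈ W Γ A, phi Γ e c = 0 → phi Γ e' c = 0) with hG
    have hAG : A ⊆ G := by
      intro e' he'
      simp only [hG, Finset.mem_filter, Finset.mem_univ, true_and]
      intro c hc _
      exact hc e' he'
    have heG : e ∈ G := by
      simp only [hG, Finset.mem_filter, Finset.mem_univ, true_and]
      intro c _ h
      exact h
    have hW : W Γ G = W Γ A ⊓ LinearMap.ker (phi Γ e) := by
      apply le_antisymm
      · intro c hc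
        exact ⟨W_anti Γ hAG hc, hc e heG⟩
      · rintro c ⟨hc, hc'⟩ e' he'
        simp only [hG, Finset.mem_filter, Finset.mem_univ, true_and] at he'
        exact he' c hc hc'
    refine ⟨G, ?_, hAG, heG, ?_, ?_⟩
    · intro e' he'
      simp only [hG, Finset.mem_filter, Finset.mem_univ, true_and]
      intro c hc hc'
      apply he'
      rw [hW]
      exact ⟨hc, hc'⟩
    · have h1 : ∃ c ∈ W Γ A, phi Γ e c ≠ 0 := by
        by_contra hcon
        push Not at hcon
        exact he (hA e hcon)
      have h2 := finrank_inf_ker h1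
      rw [hW]
      have h3 := finrank_W_le Γ A
      omega
    · intro B hB hAB heB e' he'
      simp only [hG, Finset.mem_filter, Finset.mem_univ, true_and] at he'
      apply hB
      intro c hc
      exact he' c (W_anti Γ hAB hc) (hc e heB)

/-- relation generated by a set of edges -/
def Rel (F : Finset (Dt Γ)) (a b : V) : Prop := ∃ e ∈ F, e.1.1 = a ∧ e.1.2 = b

/-- functions on the quotient -/
def quotEquiv (F : Finset (Dt Γ)) (α : Type*) :
    {c : V → α // ∀ e ∈ F, c e.1.1 = c e.1.2} ≃ (Quot (Rel Γ F) → α) where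
  toFun c := Quot.lift c.1 (by
    rintro a b ⟨e, he, rfl, rfl⟩
    exact c.2 e he)
  invFun g := ⟨fun v => g (Quot.mk _ v), fun e he => by
    exact congrArg g (Quot.sound ⟨e, he, rfl, rfl⟩)⟩
  left_inv c := rfl
  right_inv g := by
    ext x
    induction x using Quot.ind
    rfl

lemma finrank_W (F : Finset (Dt Γ)) : Module.finrank ℚ (W Γ F) = Nat.card (Quot (Rel Γ F)) := by
  have : Fintype (Quot (Rel Γ F)) := Fintype.ofFinite _
  rw [Nat.card_eq_fintype_card, ← Module.finrank_fintype_fun_eq_card ℚ]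
  let L : (Quot (Rel Γ F) → ℚ) →ₗ[ℚ] (V → ℚ) := LinearMap.funLeft ℚ ℚ (Quot.mk (Rel Γ F))
  have hL : Function.Injective L :=
    LinearMap.funLeft_injective_of_surjective ℚ ℚ _ Quot.mk_surjective
  have hr : LinearMap.range L = W Γ F := by
    ext c
    constructor
    · rintro ⟨g, rfl⟩ e he
      rw [phi_eq]
      exact ((quotEquiv Γ F ℚ).symm g).2 e he
    · intro hc
      refine ⟨quotEquiv Γ F ℚ ⟨c, fun e he => (phi_eq Γ e c).1 (hc e he)⟩, ?_⟩
      ext v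
      rfl
  rw [← hr, LinearMap.finrank_range_of_inj hL]

lemma card_const (F : Finset (Dt Γ)) (n : ℕ) :
    (Finset.univ.filter (fun c : V → Fin n => ∀ e ∈ F, c e.1.1 = c e.1.2)).card =
      n ^ Module.finrank ℚ (W Γ F) := by
  rw [finrank_W, ← Fintype.card_subtype, ← Nat.card_eq_fintype_card,
    Nat.card_congr (quotEquiv Γ F (Fin n)), Nat.card_fun, Nat.card_eq_fintype_card (α := Fin n),
    Fintype.card_fin]

/-- monochromatic edges -/
noncomputable def mono {n : ℕ} (c : V → Fin n) : Finset (Dt Γ) :=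
  Finset.univ.filter (fun e => c e.1.1 = c e.1.2)

lemma mono_flat {n : ℕ} (c : V → Fin n) : (gM Γ).IsFlat (mono Γ c) := by
  intro e he
  have h := he (fun v => ((c v).val : ℚ)) (by
    intro e' he'
    rw [phi_eq]
    simp only [mono, Finset.mem_filter, Finset.mem_univ, true_and] at he'
    rw [he'])
  rw [phi_eq] at h
  simp only [mono, Finset.mem_filter, Finset.mem_univ, true_and]
  exact Fin.ext (by exact_mod_cast h)

lemma card_coloring (n : ℕ) : Nat.card (Γ.Coloring (Fin n)) =
    (Finset.univ.filter (fun c : V → Fin n => mono Γ c = ∅)).card := by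
  rw [← Fintype.card_subtype, ← Nat.card_eq_fintype_card]
  refine Nat.card_congr ⟨fun c => ⟨c, ?_⟩, fun c => SimpleGraph.Coloring.mk c.1 ?_, ?_, ?_⟩
  · rw [mono, Finset.filter_eq_empty_iff]
    intro e _ h
    exact c.valid e.2 h
  · intro a b hab h
    have := c.2
    rw [mono, Finset.filter_eq_empty_iff] at this
    exact this (Finset.mem_univ ⟨(a, b), hab⟩) h
  · intro c
    rfl
  · intro c
    rfl

theorem count (n : ℕ) : (Nat.card (Γ.Coloring (Fin n)) : ℝ) =
    ∑ G ∈ Finset.univ.filter (fun G => (gM Γ).IsFlat G),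
      (-1 : ℝ) ^ (gM Γ).rk G * mo (gM Γ) G * (n : ℝ) ^ Module.finrank ℚ (W Γ G) := by
  have h1 : ∀ c : V → Fin n, ∑ G ∈ Finset.univ.filter (fun G => (gM Γ).IsFlat G ∧ G ⊆ mono Γ c),
      (-1 : ℝ) ^ (gM Γ).rk G * mo (gM Γ) G = if mono Γ c = ∅ then 1 else 0 := by
    intro c
    split_ifs with h
    · rw [h, Finset.sum_eq_single ∅]
      · rw [(gM Γ).rk_empty, mo_empty]; norm_num
      · intro G hG hne
        simp only [Finset.mem_filter, Finset.mem_univ, true_and] at hG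
        exact absurd (Finset.subset_empty.1 hG.2) hne
      · intro h'
        exfalso; apply h'
        simp [(gM Γ).empty]
    · exact mo_alt (mono_flat Γ c) h
  have h2 : (Nat.card (Γ.Coloring (Fin n)) : ℝ) = ∑ c : V → Fin n, if mono Γ c = ∅ then 1 else 0 := by
    rw [card_coloring, Finset.card_filter]
    push_cast
    rfl
  rw [h2]
  simp only [← h1]
  simp only [← Finset.filter_filter]
  simp only [Finset.sum_filter (fun G => G ⊆ mono Γ _)]
  rw [Finset.sum_comm]
  refine Finset.sum_congr rfl (fun G _ => ?_)
  rw [← Finset.sum_filter, Finset.sum_const, nsmul_eq_mul, mul_comm]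
  congr 1
  have h3 : (Finset.univ.filter (fun c : V → Fin n => G ⊆ mono Γ c)) =
      Finset.univ.filter (fun c : V → Fin n => ∀ e ∈ G, c e.1.1 = c e.1.2) := by
    ext c
    simp only [Finset.mem_filter, Finset.mem_univ, true_and, mono, Finset.subset_iff]
  rw [h3, card_const]
  push_cast
  rfl

theorem main (p : Polynomial ℤ)
    (hp : ∀ n : ℕ, p.eval (n : ℤ) = Nat.card (Γ.Coloring (Fin n))) (i : ℕ) (hi : 1 ≤ i) :
    |p.coeff (i - 1)| * |p.coeff (i + 1)| ≤ |p.coeff i| ^ 2 := by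
  set P : Polynomial ℝ := ∑ G ∈ Finset.univ.filter (fun G => (gM Γ).IsFlat G),
      Polynomial.C ((-1 : ℝ) ^ (gM Γ).rk G * mo (gM Γ) G) *
        Polynomial.X ^ Module.finrank ℚ (W Γ G) with hP
  have hpP : p.map (Int.castRingHom ℝ) = P := by
    refine Polynomial.eq_of_infinite_eval_eq _ _ ?_
    refine Set.Infinite.mono (s := Set.range (fun n : ℕ => (n : ℝ))) ?_
      (Set.infinite_range_of_injective Nat.cast_injective)
    rintro _ ⟨n, rfl⟩
    have h1 : (p.map (Int.castRingHom ℝ)).eval (n : ℝ) = ((p.eval (n : ℤ) : ℤ) : ℝ) := by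
      simp
    simp only [Set.mem_ofPred_eq]
    rw [h1, hp n, hP, Polynomial.eval_finsetSum]
    simp only [Polynomial.eval_mul, Polynomial.eval_C, Polynomial.eval_pow, Polynomial.eval_X]
    rw [← count]
    push_cast
    rfl
  have hc : ∀ j, (p.coeff j : ℝ) = ∑ G ∈ Finset.univ.filter (fun G => (gM Γ).IsFlat G),
      if j = Module.finrank ℚ (W Γ G) then (-1 : ℝ) ^ (gM Γ).rk G * mo (gM Γ) G else 0 := by
    intro j
    have : (p.coeff j : ℝ) = (p.map (Int.castRingHom ℝ)).coeff j := by
      rw [Polynomial.coeff_map]; rfl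
    rw [this, hpP, hP, Polynomial.finsetSum_coeff]
    simp only [Polynomial.coeff_C_mul_X_pow]
  have hrk : ∀ G, (gM Γ).rk G = Fintype.card V - Module.finrank ℚ (W Γ G) := fun _ => rfl
  have hbig : ∀ j, Fintype.card V < j → p.coeff j = 0 := by
    intro j hj
    have : (p.coeff j : ℝ) = 0 := by
      rw [hc]
      refine Finset.sum_eq_zero (fun G _ => if_neg ?_)
      have := finrank_W_le Γ G
      omega
    exact_mod_cast this
  have hsmall : ∀ j k, j + k = Fintype.card V → |(p.coeff j : ℝ)| = whit (gM Γ) k := by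
    intro j k hjk
    have : (p.coeff j : ℝ) = (-1) ^ k * whit (gM Γ) k := by
      rw [hc, whit, Finset.mul_sum, ← Finset.filter_filter, Finset.sum_filter (fun G => _ = k)]
      refine Finset.sum_congr rfl (fun G _ => ?_)
      have h1 := finrank_W_le Γ G
      have h2 := hrk G
      by_cases h : (gM Γ).rk G = k
      · rw [if_pos h, if_pos (by omega), h]
      · rw [if_neg h, if_neg (by omega)]
    rw [this, abs_mul, abs_pow, abs_neg, abs_one, one_pow, one_mul, abs_of_nonneg (whit_nonneg k)]
  by_cases h : i + 1 ≤ Fintype.card V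
  · obtain ⟨k, hk⟩ := Nat.exists_eq_add_of_le h
    have h1 := hsmall (i - 1) (k + 2) (by omega)
    have h2 := hsmall i (k + 1) (by omega)
    have h3 := hsmall (i + 1) k (by omega)
    have h4 := whit_lc' (M := gM Γ) k
    rw [← h1, ← h2, ← h3, mul_comm] at h4
    exact_mod_cast h4
  · rw [hbig (i + 1) (by omega), abs_zero, mul_zero]
    positivity

end Graph

end Part7

end HRW

/-- Huh's theorem: the absolute values of the coefficients of the chromatic
polynomial of a finite simple graph form a log-concave sequence. Here `p` is the chromatic
polynomial of `Γ`, characterized by `p(n) = ` number of proper colorings of `Γ` with `n` colors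
for every natural number `n`. -/
theorem chromatic_polynomial_log_concave {V : Type*} [Fintype V] (Γ : SimpleGraph V)
    (p : Polynomial ℤ)
    (hp : ∀ n : ℕ, p.eval (n : ℤ) = Nat.card (Γ.Coloring (Fin n))) :
    ∀ i : ℕ, 1 ≤ i → |p.coeff (i - 1)| * |p.coeff (i + 1)| ≤ |p.coeff i| ^ 2 := by
  exact HRW.main Γ p hp
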